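/- arXiv:math/0601520 — 8 statements merged into one kernel-verified Lean document; each statement's English description precedes it below -/
import Mathlib

section
/- Let v_1, …, v_q ∈ ℕ^n and let 𝒜' = {e_1, …, e_n, (v_1,1), …, (v_q,1)} ⊆ ℝ^{n+1}. Suppose the Rees cone ℝ_+𝒜' admits a representation ℝ_+𝒜' = (⋂_{i∈J} H_{e_i}^+) ∩ (⋂_{k=1}^r H_{ℓ_k}^+) for some index set J ⊆ {1,…,n+1}, where each vector ℓ_k has the form ℓ_k = −d_k e_{n+1} + Σ_{i∈A_k} e_i for some subset A_k ⊆ {1,…,n} and some d_k ∈ ℕ. Then every integral vector (a,b) ∈ ℤ^{n+1} ∩ ℝ_+𝒜' can be written as (a,b) = (c,0) + (a',b) with c ∈ ℕ^n and a' ∈ ℤ^n ∩ bP, where P = conv(v_1,…,v_q). (Ring-theoretically: the integral closure of the Rees algebra R[It] of the monomial ideal I = (x^{v_1},…,x^{v_q}) equals A(P)[x_1,…,x_n], where A(P) is the Ehrhart ring of P.) -/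
open Finset Pointwise

/-- The generators of the Rees cone of the monomial ideal generated by
`x^{v_1}, …, x^{v_q}`: the unit vectors `e_1, …, e_n` together with the
vectors `(v_j, 1)` in `ℝ^{n+1}`. -/
noncomputable def reesGen (n q : ℕ) (v : Fin q → Fin n → ℕ) :
    Fin n ⊕ Fin q → (Fin (n + 1) → ℝ)
  | Sum.inl i => Pi.single i.castSucc 1
  | Sum.inr j => Fin.snoc (fun i => (v j i : ℝ)) 1

/-- The Rees cone: all nonnegative real linear combinations of the generators. -/
noncomputable def reesCone (n q : ℕ) (v : Fin q → Fin n → ℕ) :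
    Set (Fin (n + 1) → ℝ) :=
  {y | ∃ lam : Fin n ⊕ Fin q → ℝ, (∀ s, 0 ≤ lam s) ∧ y = ∑ s, lam s • reesGen n q v s}

/-- A point lies in the Rees cone iff it is the sum of a nonnegative vector in the first `n`
coordinates and a nonnegative combination of the vectors `(v_j, 1)`. -/
theorem mem_reesCone_iff {n q : ℕ} {v : Fin q → Fin n → ℕ} {y : Fin (n + 1) → ℝ} :
    y ∈ reesCone n q v ↔ ∃ (s : Fin n → ℝ) (μ : Fin q → ℝ), (∀ i, 0 ≤ s i) ∧ (∀ j, 0 ≤ μ j) ∧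
      (∀ i, y i.castSucc = s i + ∑ j, μ j * v j i) ∧ y (Fin.last n) = ∑ j, μ j := by
  have key (lam : Fin n ⊕ Fin q → ℝ) : y = ∑ t, lam t • reesGen n q v t ↔
      (∀ i : Fin n, y i.castSucc = lam (Sum.inl i) + ∑ j, lam (Sum.inr j) * v j i) ∧
        y (Fin.last n) = ∑ j, lam (Sum.inr j) := by
    rw [funext_iff, Fin.forall_fin_succ']
    simp [Fintype.sum_sum_type, reesGen, Finset.sum_apply, Pi.single_apply,
      (Fin.castSucc_lt_last _).ne']
  constructor
  · rintro ⟨lam, hlam, hy⟩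
    exact ⟨fun i => lam (Sum.inl i), fun j => lam (Sum.inr j), fun i => hlam _, fun j => hlam _,
      (key lam).1 hy⟩
  · rintro ⟨s, μ, hs, hμ, hy⟩
    exact ⟨Sum.elim s μ, by rintro (i | j) <;> simp [hs, hμ], (key _).2 (by simpa using hy)⟩

/-- A nonnegative combination of points of `S` lies in the dilate of `convexHull ℝ S` by the
total weight. -/
theorem sum_smul_mem_smul_convexHull {ι E : Type*} [Fintype ι] [Nonempty ι] [AddCommGroup E]
    [Module ℝ E] (μ : ι → ℝ) (hμ : ∀ j, 0 ≤ μ j) (p : ι → E) :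
    ∑ j, μ j • p j ∈ (∑ j, μ j) • convexHull ℝ (Set.range p) := by
  have hmem (j : ι) : p j ∈ convexHull ℝ (Set.range p) :=
    subset_convexHull ℝ _ (Set.mem_range_self j)
  rcases (Finset.sum_nonneg fun j _ => hμ j : 0 ≤ ∑ j, μ j).eq_or_lt with h | h
  · have h0 : ∀ j, μ j = 0 := by
      simpa using (Finset.sum_eq_zero_iff_of_nonneg fun j _ => hμ j).1 h.symm
    exact ⟨p (Classical.arbitrary ι), hmem _, by simp [h0]⟩
  · refine ⟨univ.centerMass μ p,
      (convex_convexHull ℝ _).centerMass_mem (fun j _ => hμ j) h fun j _ => hmem j, ?_⟩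
    simp [Finset.centerMass, smul_smul, h.ne']

/-- The functional with normal vector `∑_{i ∈ A} e_i - d e_{n+1}`. -/
theorem sum_quasiIdeal_normal_mul {n : ℕ} (A : Finset (Fin n)) (d : ℝ) (y : Fin (n + 1) → ℝ) :
    ∑ i, ((∑ i ∈ A, Pi.single i.castSucc (1 : ℝ)) -
      d • (Pi.single (Fin.last n) 1 : Fin (n + 1) → ℝ) : Fin (n + 1) → ℝ) i * y i =
      ∑ i ∈ A, y i.castSucc - d * y (Fin.last n) := by
  simp only [Fin.sum_univ_castSucc]
  simp [Finset.sum_apply, Pi.single_apply, (Fin.castSucc_lt_last _).ne',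
    (Fin.castSucc_lt_last _).ne, sub_eq_add_neg]

/-- If a lattice point of the cone has a decomposition with positive `i`-th slack, then the
unit vector `e_i` can be subtracted without leaving the cone. -/
theorem sub_single_mem_reesCone
    {n q : ℕ} {v : Fin q → Fin n → ℕ}
    {J : Finset (Fin (n + 1))} {r : ℕ} {ℓ : Fin r → Fin (n + 1) → ℝ}
    (hℓ : ∀ k, ∃ (A : Finset (Fin n)) (dk : ℕ),
      ℓ k = (∑ i ∈ A, Pi.single i.castSucc (1 : ℝ)) -
        (dk : ℝ) • (Pi.single (Fin.last n) 1 : Fin (n + 1) → ℝ))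
    (hrep : reesCone n q v =
      {y : Fin (n + 1) → ℝ | (∀ i ∈ J, 0 ≤ y i) ∧ ∀ k, 0 ≤ ∑ i, ℓ k i * y i})
    {z : Fin (n + 1) → ℤ} {s : Fin n → ℝ} {μ : Fin q → ℝ}
    (hs : ∀ i, 0 ≤ s i) (hμ : ∀ j, 0 ≤ μ j)
    (hz : ∀ i : Fin n, (z i.castSucc : ℝ) = s i + ∑ j, μ j * v j i)
    (hlast : (z (Fin.last n) : ℝ) = ∑ j, μ j) {i : Fin n} (hi : 0 < s i) :
    (fun t => ((z - Pi.single i.castSucc 1 : Fin (n + 1) → ℤ) t : ℝ)) ∈ reesCone n q v := by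
  have hsum (t : Fin n) : 0 ≤ ∑ j, μ j * (v j t : ℝ) :=
    Finset.sum_nonneg fun j _ => mul_nonneg (hμ j) (Nat.cast_nonneg _)
  have hp : (Fin.snoc (fun t => ∑ j, μ j * (v j t : ℝ)) (∑ j, μ j) : Fin (n + 1) → ℝ) ∈
      reesCone n q v :=
    mem_reesCone_iff.2 ⟨0, μ, fun _ => le_rfl, hμ, by simp, by simp⟩
  have hzC : (fun t => (z t : ℝ)) ∈ reesCone n q v :=
    mem_reesCone_iff.2 ⟨s, μ, hs, hμ, hz, hlast⟩
  have hzi : 1 ≤ z i.castSucc := by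
    have : (0 : ℝ) < z i.castSucc := by rw [hz]; linarith [hsum i]
    exact_mod_cast this
  rw [hrep] at hp hzC ⊢
  refine ⟨fun t ht => ?_, fun k => ?_⟩
  · have h0 : (0 : ℝ) ≤ z t := hzC.1 t ht
    rcases eq_or_ne t i.castSucc with rfl | hne
    · simpa using (by exact_mod_cast hzi : (1 : ℝ) ≤ z i.castSucc)
    · simpa [hne] using h0
  · obtain ⟨A, d, hk⟩ := hℓ k
    have hpk := hp.2 k
    have hzk := hzC.2 k
    rw [hk, sum_quasiIdeal_normal_mul] at hpk hzk ⊢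
    simp only [Fin.snoc_castSucc, Fin.snoc_last] at hpk
    by_cases hiA : i ∈ A
    · have hsA : s i ≤ ∑ t ∈ A, s t :=
        Finset.single_le_sum (f := s) (fun t _ => hs t) hiA
      have hpos : (0 : ℝ) < ∑ t ∈ A, (z t.castSucc : ℝ) - d * z (Fin.last n) := by
        simp only [hz, hlast, Finset.sum_add_distrib]
        linarith
      have hint : (1 : ℤ) ≤ ∑ t ∈ A, z t.castSucc - d * z (Fin.last n) := by
        exact_mod_cast hpos
      have hreal : (1 : ℝ) ≤ ∑ t ∈ A, (z t.castSucc : ℝ) - d * z (Fin.last n) := by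
        exact_mod_cast hint
      simp [Pi.single_apply, (Fin.castSucc_lt_last _).ne', hiA] at hreal ⊢
      linarith
    · simpa [Pi.single_apply, (Fin.castSucc_lt_last _).ne', hiA] using hzk

/-- If the Rees cone admits a representation by halfspaces `H_{e_i}^+` (for `i ∈ J`)
and `H_{ℓ_k}^+` where each `ℓ_k = -d_k e_{n+1} + ∑_{i ∈ A_k} e_i`, then every lattice
point `(a, b)` of the Rees cone decomposes as `(c, 0) + (a', b)` with `c ∈ ℕ^n` and
`a' ∈ ℤ^n ∩ bP`, where `P = conv(v_1, …, v_q)`. -/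
theorem rees_cone_quasi_ideal_normalization
    (n q : ℕ) (hq : 0 < q) (v : Fin q → Fin n → ℕ)
    (J : Finset (Fin (n + 1))) (r : ℕ) (ℓ : Fin r → Fin (n + 1) → ℝ)
    (hℓ : ∀ k, ∃ (A : Finset (Fin n)) (dk : ℕ),
      ℓ k = (∑ i ∈ A, Pi.single i.castSucc (1 : ℝ)) - (dk : ℝ) • (Pi.single (Fin.last n) 1 : Fin (n + 1) → ℝ))
    (hrep : reesCone n q v =
      {y : Fin (n + 1) → ℝ | (∀ i ∈ J, 0 ≤ y i) ∧ ∀ k, 0 ≤ ∑ i, ℓ k i * y i})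
    (z : Fin (n + 1) → ℤ)
    (hz : (fun i => (z i : ℝ)) ∈ reesCone n q v) :
    ∃ (c : Fin n → ℕ) (a' : Fin n → ℤ),
      (∀ i : Fin n, z i.castSucc = (c i : ℤ) + a' i) ∧
      (fun i => (a' i : ℝ)) ∈ (z (Fin.last n) : ℝ) •
        convexHull ℝ (Set.range fun j : Fin q => fun i : Fin n => (v j i : ℝ)) := by
  have : Nonempty (Fin q) := ⟨⟨0, hq⟩⟩
  induction hN : (∑ i : Fin n, z i.castSucc).toNat using Nat.strong_induction_on generalizing z with
  | _ N ih =>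
    obtain ⟨s, μ, hs, hμ, hzs, hlast⟩ := mem_reesCone_iff.1 hz
    by_cases h : ∃ i, 0 < s i
    · obtain ⟨i, hi⟩ := h
      have hmem := sub_single_mem_reesCone hℓ hrep hs hμ hzs hlast hi
      have hsum : ∑ t : Fin n, (z - Pi.single i.castSucc 1 : Fin (n + 1) → ℤ) t.castSucc =
          ∑ t : Fin n, z t.castSucc - 1 := by
        simp [Pi.single_apply]
      have hpos : 0 < ∑ t : Fin n, z t.castSucc := by
        have hle : s i ≤ ∑ t, s t := Finset.single_le_sum (fun t _ => hs t) (mem_univ i)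
        have hnn : 0 ≤ ∑ t, ∑ j, μ j * (v j t : ℝ) :=
          Finset.sum_nonneg fun t _ =>
            Finset.sum_nonneg fun j _ => mul_nonneg (hμ j) (Nat.cast_nonneg _)
        have : (0 : ℝ) < ∑ t : Fin n, (z t.castSucc : ℝ) := by
          simp only [hzs, Finset.sum_add_distrib]
          linarith
        exact_mod_cast this
      obtain ⟨c, a', hc, ha'⟩ := ih _ (by omega) _ hmem rfl
      refine ⟨c + Pi.single i 1, a', fun t => ?_, ?_⟩
      · have := hc t
        simp only [Pi.sub_apply, Pi.add_apply, Pi.single_apply, Fin.castSucc_inj] at this ⊢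
        split_ifs at this ⊢ <;> push_cast <;> omega
      · simpa [Pi.single_apply, (Fin.castSucc_lt_last _).ne'] using ha'
    · have hs0 (i : Fin n) : s i = 0 := le_antisymm (not_lt.1 fun hi => h ⟨i, hi⟩) (hs i)
      refine ⟨0, fun i => z i.castSucc, fun i => by simp, ?_⟩
      rw [hlast]
      convert sum_smul_mem_smul_convexHull μ hμ fun j (i : Fin n) => (v j i : ℝ) using 1
      ext i
      simp [hzs, hs0, Finset.sum_apply]
end

section
/- Let M be a matroid of rank d on [n] with bases B_1,…,B_q, and let 𝒜' = {e_1,…,e_n, f_{B_1},…,f_{B_q}} ⊆ ℝ^{n+1}. Let b = (b_1,…,b_{n+1}) ∈ ℤ^{n+1} be a nonzero vector whose nonzero entries are relatively prime (have gcd 1), such that: (a) ℝ_+𝒜' ⊆ H_b^+ and ℝ_+𝒜' ∩ H_b ≠ ℝ_+𝒜', and (b) the set 𝒜' ∩ H_b contains n linearly independent vectors (so ℝ_+𝒜' ∩ H_b is a facet of the (n+1)-dimensional cone ℝ_+𝒜'). Then either b = e_i for some i ∈ [n+1], or b_i ∈ {0,1} for all i ∈ [n] and b_{n+1} ≥ −d.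 In particular the basis Rees cone of M is quasi-ideal. -/
open Finset

/-- A collection `𝓘` of subsets of `[n]` is the family of independent sets of a
matroid on `[n]` if it contains the empty set, is closed under taking subsets,
and satisfies the augmentation (independence exchange) axiom. -/
def IndepSystem {n : ℕ} (𝓘 : Set (Finset (Fin n))) : Prop :=
  ∅ ∈ 𝓘 ∧
  (∀ I ∈ 𝓘, ∀ I' ⊆ I, I' ∈ 𝓘) ∧
  (∀ I₁ ∈ 𝓘, ∀ I₂ ∈ 𝓘, I₁.card < I₂.card → ∃ e ∈ I₂, e ∉ I₁ ∧ insert e I₁ ∈ 𝓘)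

/-- A basis of the matroid with independent sets `𝓘` is a maximal independent set. -/
def IsBasisOf {n : ℕ} (𝓘 : Set (Finset (Fin n))) (B : Finset (Fin n)) : Prop :=
  B ∈ 𝓘 ∧ ∀ I ∈ 𝓘, B ⊆ I → I = B

/-- The generators of the basis Rees cone of a matroid with bases `B_1, …, B_q`:
the unit vectors `e_1, …, e_n` together with the vectors
`f_{B_j} = e_{n+1} + ∑_{i ∈ B_j} e_i` in `ℝ^{n+1}`. -/
noncomputable def basisReesGen (n q : ℕ) (B : Fin q → Finset (Fin n)) :
    Fin n ⊕ Fin q → (Fin (n + 1) → ℝ)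
  | Sum.inl i => Pi.single i.castSucc 1
  | Sum.inr j => Fin.snoc (fun i => if i ∈ B j then (1 : ℝ) else 0) 1

/-- The basis Rees cone: all nonnegative real linear combinations of the generators. -/
noncomputable def basisReesCone (n q : ℕ) (B : Fin q → Finset (Fin n)) :
    Set (Fin (n + 1) → ℝ) :=
  {y | ∃ lam : Fin n ⊕ Fin q → ℝ, (∀ s, 0 ≤ lam s) ∧
    y = ∑ s, lam s • basisReesGen n q B s}

open Matrix in
/-- In codimension one, the vectors orthogonal to a linearly independent family are proportional. -/
theorem exists_smul_eq_of_dotProduct_eq_zero {ι m K : Type*} [Fintype ι] [Fintype m] [Field K]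
    {v : m → ι → K} (hv : LinearIndependent K v) (hcard : Fintype.card ι = Fintype.card m + 1)
    {x y : ι → K} (hx : ∀ j, v j ⬝ᵥ x = 0) (hy : ∀ j, v j ⬝ᵥ y = 0) (hx0 : x ≠ 0) :
    ∃ c : K, c • x = y := by
  classical
  let A : Matrix m ι K := Matrix.of v
  have hrank : A.rank = Fintype.card m := LinearIndependent.rank_matrix (M := A) hv
  have hker : Module.finrank K (LinearMap.ker A.mulVecLin) = 1 := by
    have h := LinearMap.finrank_range_add_finrank_ker A.mulVecLin
    rw [Module.finrank_fintype_fun_eq_card] at h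
    change A.rank + _ = _ at h
    omega
  have hxA : x ∈ LinearMap.ker A.mulVecLin := funext hx
  have hyA : y ∈ LinearMap.ker A.mulVecLin := funext hy
  obtain ⟨c, hc⟩ := exists_smul_eq_of_finrank_eq_one hker
    (x := ⟨x, hxA⟩) (fun h => hx0 (congrArg Subtype.val h)) ⟨y, hyA⟩
  exact ⟨c, congrArg Subtype.val hc⟩

namespace IndepSystem

variable {n : ℕ} {𝓘 : Set (Finset (Fin n))}

theorem exists_isBasisOf_superset {I : Finset (Fin n)} (hI : I ∈ 𝓘) :
    ∃ S, IsBasisOf 𝓘 S ∧ I ⊆ S := by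
  obtain ⟨S, hIS, hS⟩ := (Set.toFinite 𝓘).exists_le_maximal hI
  exact ⟨S, ⟨hS.prop, fun T hT hST => (hS.eq_of_le hT hST).symm⟩, hIS⟩

theorem card_le_of_isBasisOf (h : IndepSystem 𝓘) {S I : Finset (Fin n)} (hS : IsBasisOf 𝓘 S)
    (hI : I ∈ 𝓘) : I.card ≤ S.card := by
  by_contra! hlt
  obtain ⟨e, -, heS, hins⟩ := h.2.2 S hS.1 I hI hlt
  exact heS (hS.2 _ hins (subset_insert e S) ▸ mem_insert_self e S)

theorem isBasisOf_of_card_le (h : IndepSystem 𝓘) {S J : Finset (Fin n)} (hS : IsBasisOf 𝓘 S)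
    (hJ : J ∈ 𝓘) (hcard : S.card ≤ J.card) : IsBasisOf 𝓘 J :=
  ⟨hJ, fun _ hI hJI => (eq_of_subset_of_card_le hJI
    ((h.card_le_of_isBasisOf hS hI).trans hcard)).symm⟩

/-- An independent set extends to a basis using only elements of a given basis. -/
theorem exists_isBasisOf_subset_union (h : IndepSystem 𝓘) {S I : Finset (Fin n)}
    (hS : IsBasisOf 𝓘 S) (hI : I ∈ 𝓘) :
    ∃ J, IsBasisOf 𝓘 J ∧ I ⊆ J ∧ J ⊆ I ∪ S := by
  obtain ⟨J, hIJ, hJ⟩ := (Set.toFinite {J | J ∈ 𝓘 ∧ J ⊆ I ∪ S}).exists_le_maximal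
    ⟨hI, subset_union_left⟩
  refine ⟨J, h.isBasisOf_of_card_le hS hJ.prop.1 ?_, hIJ, hJ.prop.2⟩
  by_contra! hlt
  obtain ⟨e, heS, heJ, hins⟩ := h.2.2 J hJ.prop.1 S hS.1 hlt
  have heq := hJ.eq_of_le ⟨hins, insert_subset (mem_union_right _ heS) hJ.prop.2⟩
    (subset_insert e J)
  exact heJ (heq ▸ mem_insert_self e J)

/-- Among the elements of maximal weight `t`, a basis of minimal weight uses no more than any
other basis does. -/
theorem card_filter_eq_le_of_minimal (h : IndepSystem 𝓘) {w : Fin n → ℤ} {t : ℤ}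
    (ht : ∀ i, w i ≤ t) {S T : Finset (Fin n)} (hS : IsBasisOf 𝓘 S) (hT : IsBasisOf 𝓘 T)
    (hmin : ∀ J, IsBasisOf 𝓘 J → ∑ i ∈ S, w i ≤ ∑ i ∈ J, w i) :
    (S.filter (w · = t)).card ≤ (T.filter (w · = t)).card := by
  by_contra! hlt
  have hcard : S.card = T.card :=
    (h.card_le_of_isBasisOf hT hS.1).antisymm (h.card_le_of_isBasisOf hS hT.1)
  have hScard := S.card_filter_add_card_filter_not (w · = t)
  have hTcard := T.card_filter_add_card_filter_not (w · = t)
  obtain ⟨e, heT, heS, hins⟩ := h.2.2 (S.filter (¬ w · = t)) (h.2.1 S hS.1 _ (filter_subset _ _))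
    (T.filter (¬ w · = t)) (h.2.1 T hT.1 _ (filter_subset _ _)) (by omega)
  have het : w e ≠ t := (mem_filter.1 heT).2
  have heS : e ∉ S := fun he => heS (mem_filter.2 ⟨he, het⟩)
  obtain ⟨J, hJ, hIJ, hJS⟩ := h.exists_isBasisOf_subset_union hS hins
  have hJS : J ⊆ insert e S := hJS.trans <| union_subset
    (insert_subset_insert _ (filter_subset _ _)) (subset_insert _ _)
  have hJcard : J.card = S.card :=
    (h.card_le_of_isBasisOf hS hJ.1).antisymm (h.card_le_of_isBasisOf hJ hS.1)
  have hdiff : (insert e S \ J).card = 1 := by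
    rw [card_sdiff_of_subset hJS, card_insert_of_notMem heS]
    omega
  obtain ⟨f, hf⟩ := card_eq_one.1 hdiff
  have hfmem : f ∈ insert e S \ J := hf ▸ mem_singleton_self f
  obtain ⟨hfS, hfJ⟩ := mem_sdiff.1 hfmem
  have hft : w f = t := by
    by_contra hft
    refine hfJ (hIJ ?_)
    rcases mem_insert.1 hfS with rfl | hfS
    · exact mem_insert_self _ _
    · exact mem_insert_of_mem (mem_filter.2 ⟨hfS, hft⟩)
  have hsum := sum_sdiff (f := w) hJS
  rw [hf, sum_singleton, sum_insert heS, hft] at hsum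
  have := hmin J hJ
  have := lt_of_le_of_ne (ht e) het
  omega

end IndepSystem

section BasisReesCone

variable {n q : ℕ} {B : Fin q → Finset (Fin n)}

theorem basisReesGen_mem_basisReesCone (s : Fin n ⊕ Fin q) :
    basisReesGen n q B s ∈ basisReesCone n q B := by
  classical
  refine ⟨Pi.single s 1, fun t => ?_, ?_⟩
  · by_cases h : t = s <;> simp [h]
  · simp [Pi.single_apply]

theorem sum_mul_basisReesGen_inl (a : Fin (n + 1) → ℝ) (i : Fin n) :
    ∑ k, a k * basisReesGen n q B (Sum.inl i) k = a i.castSucc := by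
  simp [basisReesGen, Pi.single_apply]

theorem sum_mul_basisReesGen_inr (a : Fin (n + 1) → ℝ) (j : Fin q) :
    ∑ k, a k * basisReesGen n q B (Sum.inr j) k = ∑ i ∈ B j, a i.castSucc + a (Fin.last n) := by
  simp [basisReesGen, Fin.sum_univ_castSucc]

end BasisReesCone

/-- Facets of the basis Rees cone of a matroid of rank `d`: if `b` is a primitive
integral supporting normal of a facet of the basis Rees cone, then either `b` is a
unit vector, or all its first `n` entries are in `{0,1}` and its last entry is
at least `-d`.  In particular the basis Rees cone is quasi-ideal. -/
theorem basis_rees_cone_facets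
    (n q d : ℕ) (𝓘 : Set (Finset (Fin n))) (h𝓘 : IndepSystem 𝓘)
    (B : Fin q → Finset (Fin n))
    (hB : ∀ j, IsBasisOf 𝓘 (B j))
    (hall : ∀ S, IsBasisOf 𝓘 S → ∃ j, B j = S)
    (hrank : ∀ j, (B j).card = d)
    (b : Fin (n + 1) → ℤ) (hb0 : b ≠ 0)
    (hprim : Finset.univ.gcd b = 1)
    (hsupp : basisReesCone n q B ⊆ {y | 0 ≤ ∑ i, (b i : ℝ) * y i})
    (hproper : basisReesCone n q B ∩ {y | ∑ i, (b i : ℝ) * y i = 0} ≠ basisReesCone n q B)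
    (hfacet : ∃ s : Finset (Fin n ⊕ Fin q), s.card = n ∧
      (∀ j ∈ s, ∑ i, (b i : ℝ) * basisReesGen n q B j i = 0) ∧
      LinearIndependent ℝ (fun j : s => basisReesGen n q B (j : Fin n ⊕ Fin q))) :
    (∃ i : Fin (n + 1), b = Pi.single i 1) ∨
      ((∀ i : Fin n, b i.castSucc = 0 ∨ b i.castSucc = 1) ∧
        -(d : ℤ) ≤ b (Fin.last n)) := by
  have hnonneg : ∀ i : Fin n, 0 ≤ b i.castSucc := fun i => by
    have h := hsupp (basisReesGen_mem_basisReesCone (Sum.inl i))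
    rw [Set.mem_ofPred_eq, sum_mul_basisReesGen_inl] at h
    exact_mod_cast h
  have hbasis : ∀ S, IsBasisOf 𝓘 S → 0 ≤ ∑ i ∈ S, b i.castSucc + b (Fin.last n) := fun S hS => by
    obtain ⟨j, rfl⟩ := hall S hS
    have h := hsupp (basisReesGen_mem_basisReesCone (Sum.inr j))
    rw [Set.mem_ofPred_eq, sum_mul_basisReesGen_inr] at h
    exact_mod_cast h
  obtain ⟨s, hscard, hs, hli⟩ := hfacet
  have hinl : ∀ i, Sum.inl i ∈ s → b i.castSucc = 0 := fun i hi => by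
    have h := hs _ hi
    rw [sum_mul_basisReesGen_inl] at h
    exact_mod_cast h
  have hinr : ∀ j, Sum.inr j ∈ s → ∑ i ∈ B j, b i.castSucc + b (Fin.last n) = 0 := fun j hj => by
    have h := hs _ hj
    rw [sum_mul_basisReesGen_inr] at h
    exact_mod_cast h
  have hunit : ∀ t : ℤ, 0 ≤ t → (∀ i, t ∣ b i) → t = 1 := fun t ht hdvd =>
    Int.eq_one_of_dvd_one ht (hprim ▸ Finset.dvd_gcd fun i _ => hdvd i)
  by_cases hw : ∀ i : Fin n, b i.castSucc = 0
  · left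
    obtain ⟨S, hS, -⟩ := IndepSystem.exists_isBasisOf_superset h𝓘.1
    have hlast : 0 ≤ b (Fin.last n) := by simpa [hw] using hbasis S hS
    refine ⟨Fin.last n, funext fun k => ?_⟩
    induction k using Fin.lastCases with
    | last =>
      rw [Pi.single_eq_same]
      exact hunit _ hlast fun i => by
        induction i using Fin.lastCases <;> simp [hw]
    | cast i => simp [hw, Fin.castSucc_ne_last]
  right
  obtain ⟨i₀, hi₀⟩ := not_forall.1 hw
  obtain ⟨m, -, hm⟩ := exists_max_image univ (fun i : Fin n => b i.castSucc) ⟨i₀, mem_univ _⟩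
  obtain ⟨t, htm⟩ : ∃ t, t = b m.castSucc := ⟨_, rfl⟩
  have ht : ∀ i : Fin n, b i.castSucc ≤ t := fun i => htm ▸ hm i (mem_univ i)
  have htpos : 0 < t := ((hnonneg i₀).lt_of_ne' hi₀).trans_le (ht i₀)
  obtain ⟨j₀, hj₀⟩ : ∃ j, Sum.inr j ∈ s := by
    by_contra! hno
    have hsub : s ⊆ univ.map ⟨Sum.inl, Sum.inl_injective⟩ := fun x hx => by
      rcases x with i | j
      · simp
      · exact absurd hx (hno j)
    have heq := eq_of_subset_of_card_le hsub (by simp [hscard])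
    exact hi₀ (hinl i₀ (heq ▸ by simp))
  have hmin : ∀ j, Sum.inr j ∈ s → ∀ J, IsBasisOf 𝓘 J →
      ∑ i ∈ B j, b i.castSucc ≤ ∑ i ∈ J, b i.castSucc := fun j hj J hJ => by
    have := hinr j hj
    have := hbasis J hJ
    omega
  -- the candidate normal vector supported on the elements of maximal weight
  let u : Fin (n + 1) → ℝ := Fin.snoc (fun i => if b i.castSucc = t then (1 : ℝ) else 0)
    (-(((B j₀).filter (fun i => b i.castSucc = t)).card : ℝ))
  have hu : ∀ i : Fin n, u i.castSucc = if b i.castSucc = t then (1 : ℝ) else 0 := fun i => by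
    simp [u]
  have hulast : u (Fin.last n) = -(((B j₀).filter (fun i => b i.castSucc = t)).card : ℝ) := by
    simp [u]
  have hu0 : u ≠ 0 := fun h => by
    have := congrFun h m.castSucc
    simp [hu, htm] at this
  have hus : ∀ x ∈ s, ∑ k, u k * basisReesGen n q B x k = 0 := by
    rintro (i | j) hx
    · rw [sum_mul_basisReesGen_inl, hu, hinl i hx, if_neg htpos.ne]
    · have hcard := (h𝓘.card_filter_eq_le_of_minimal ht (hB j) (hB j₀) (hmin j hx)).antisymm
        (h𝓘.card_filter_eq_le_of_minimal ht (hB j₀) (hB j) (hmin j₀ hj₀))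
      rw [sum_mul_basisReesGen_inr, hulast, ← hcard]
      simp [hu]
  obtain ⟨c, hc⟩ := exists_smul_eq_of_dotProduct_eq_zero (x := u) (y := fun i => (b i : ℝ)) hli
    (by simp [hscard])
    (fun x => by rw [dotProduct_comm]; exact hus x x.2)
    (fun x => by rw [dotProduct_comm]; exact hs x x.2) hu0
  have hsupport : ∀ i : Fin n, b i.castSucc = 0 ∨ b i.castSucc = t := fun i => by
    by_cases hi : b i.castSucc = t
    · exact Or.inr hi
    · have := congrFun hc i.castSucc
      simp only [Pi.smul_apply, hu, if_neg hi, smul_zero] at this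
      exact Or.inl (by exact_mod_cast this.symm)
  have ht1 : t = 1 := hunit t htpos.le fun i => by
    have hcast : ∀ i : Fin n, t ∣ b i.castSucc := fun i => by
      rcases hsupport i with h | h <;> simp [h]
    induction i using Fin.lastCases with
    | last => exact (dvd_add_right (dvd_sum fun i _ => hcast i)).1 (hinr j₀ hj₀ ▸ dvd_zero t)
    | cast i => exact hcast i
  refine ⟨fun i => ht1 ▸ hsupport i, ?_⟩
  have hle : ∑ i ∈ B j₀, b i.castSucc ≤ d := by
    have := sum_le_card_nsmul (B j₀) (fun i => b i.castSucc) 1 fun i _ => ht1 ▸ ht i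
    simpa [hrank] using this
  have := hinr j₀ hj₀
  omega
end

section
/- Let M be a matroid of rank d on [n] with set of bases 𝓑. Suppose a ∈ ℕ^n satisfies a_1 + ⋯ + a_n = ℓd for some ℓ ∈ ℕ, and suppose there exists a positive integer p such that p·a is a sum of indicator vectors of bases of M (with repetitions allowed), i.e., p·a lies in the subsemigroup of ℕ^n generated by {Σ_{j∈B} e_j : B ∈ 𝓑}. Then a itself is a sum of indicator vectors of bases of M. (Ring-theoretically: the basis monomial ring k[F_M] of M is normal, where F_M is the set of monomials x_{i_1}⋯x_{i_d} with {i_1,…,i_d} a basis of M.) -/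
open Finset

section

variable {n : ℕ} {𝓘 : Set (Finset (Fin n))}

/-- An independent set extends, inside its union with a larger independent set, to an independent
set of the larger cardinality. -/
theorem IndepSystem.exists_extension (h : IndepSystem 𝓘) {K I : Finset (Fin n)}
    (hK : K ∈ 𝓘) (hI : I ∈ 𝓘) (hle : #K ≤ #I) :
    ∃ L ∈ 𝓘, K ⊆ L ∧ L ⊆ K ∪ I ∧ #L = #I := by
  induction hm : #I - #K generalizing K with
  | zero => exact ⟨K, hK, Subset.rfl, subset_union_left, by omega⟩
  | succ m ih =>
    obtain ⟨e, heI, heK, hins⟩ := h.2.2 K hK I hI (by omega)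
    have hc := card_insert_of_notMem heK
    obtain ⟨L, hL, hKL, hLI, hcard⟩ := ih hins (by omega) (by omega)
    refine ⟨L, hL, (subset_insert e K).trans hKL, hLI.trans ?_, hcard⟩
    intro x
    simp only [mem_union, mem_insert]
    rintro ((rfl | hx) | hx) <;> tauto

/-- Adjoining `x` to `J` gives no larger independent set; for independent `J` this says that `x`
lies in the closure of `J`. -/
def InsertAbsorbs (𝓘 : Set (Finset (Fin n))) (J : Finset (Fin n)) (x : Fin n) : Prop :=
  insert x J ∈ 𝓘 → x ∈ J

theorem IndepSystem.absorbs_exchange (h : IndepSystem 𝓘) {J : Finset (Fin n)} {e y x : Fin n}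
    (hJ : J ∈ 𝓘) (hy : y ∈ J) (he : e ∉ J) (hdep : insert e J ∉ 𝓘) (hx : InsertAbsorbs 𝓘 J x) :
    InsertAbsorbs 𝓘 (insert e (J.erase y)) x := by
  intro hins
  by_contra hxJ
  have hey : e ∉ J.erase y := fun hh => he (mem_of_mem_erase hh)
  have hcard : #J < #(insert x (insert e (J.erase y))) := by
    rw [card_insert_of_notMem hxJ, card_insert_of_notMem hey, card_erase_of_mem hy]
    omega
  obtain ⟨z, hz, hzJ, hzI⟩ := h.2.2 J hJ _ hins hcard
  rcases mem_insert.1 hz with rfl | hz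
  · exact hzJ (hx hzI)
  · rcases mem_insert.1 hz with rfl | hz
    · exact hdep hzI
    · exact hzJ (mem_of_mem_erase hz)

theorem IndepSystem.absorbs_exchange_iff (h : IndepSystem 𝓘) {J : Finset (Fin n)} {e y x : Fin n}
    (hJ : J ∈ 𝓘) (hy : y ∈ J) (he : e ∉ J) (hdep : insert e J ∉ 𝓘)
    (hJ' : insert e (J.erase y) ∈ 𝓘) :
    InsertAbsorbs 𝓘 (insert e (J.erase y)) x ↔ InsertAbsorbs 𝓘 J x := by
  refine ⟨fun hx => ?_, h.absorbs_exchange hJ hy he hdep⟩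
  have hey : e ≠ y := fun hh => he (hh ▸ hy)
  have heq : insert y (insert e (J.erase y)) = insert e J := by
    rw [insert_comm, insert_erase hy]
  have hback : insert y ((insert e (J.erase y)).erase e) = J := by
    rw [erase_insert (fun hh => he (mem_of_mem_erase hh)), insert_erase hy]
  have := h.absorbs_exchange hJ' (mem_insert_self e _) (y := e) (e := y) (x := x)
    (by simp [hey.symm]) (heq ▸ hdep) hx
  rwa [hback] at this

/-- If every exchange of `e` into `I` removes an element of `S`, then `e` is already in the closure
of `I ∩ S`. -/
theorem IndepSystem.insert_inter_notMem (h : IndepSystem 𝓘) {I S : Finset (Fin n)} {e : Fin n}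
    (hI : I ∈ 𝓘) (he : e ∉ I) (hdep : insert e I ∉ 𝓘)
    (hS : ∀ y ∈ I, insert e (I.erase y) ∈ 𝓘 → y ∈ S) : insert e (I ∩ S) ∉ 𝓘 := by
  intro hK
  have hle : #(insert e (I ∩ S)) ≤ #I := by
    have hne : I ∩ S ≠ I := fun hh => hdep (hh ▸ hK)
    have := card_lt_card (Finset.ssubset_iff_subset_ne.2 ⟨inter_subset_left, hne⟩)
    have := card_insert_le e (I ∩ S)
    omega
  obtain ⟨L, hL, hKL, hLI, hcard⟩ := h.exists_extension hK hI hle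
  have heL : e ∈ L := hKL (mem_insert_self _ _)
  have hnot : ¬ I ⊆ L := by
    intro hsub
    rw [← eq_of_subset_of_card_le hsub hcard.le] at heL
    exact he heL
  obtain ⟨y, hyI, hyL⟩ := not_subset.1 hnot
  have hsub : L ⊆ insert e (I.erase y) := by
    intro x hx
    have hxy : x ≠ y := fun hh => hyL (hh ▸ hx)
    have := hLI hx
    simp only [mem_union, mem_insert, mem_inter] at this
    simp only [mem_insert, mem_erase]
    tauto
  have hLeq : L = insert e (I.erase y) := by
    refine eq_of_subset_of_card_le hsub ?_
    rw [card_insert_of_notMem (fun hh => he (mem_of_mem_erase hh)), card_erase_of_mem hyI, hcard]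
    have := card_pos.2 ⟨y, hyI⟩
    omega
  have hyS := hS y hyI (hLeq ▸ hL)
  exact hyL (hKL (mem_insert_of_mem (mem_inter.2 ⟨hyI, hyS⟩)))

theorem IndepSystem.card_le_of_absorbs (h : IndepSystem 𝓘) {J K S : Finset (Fin n)}
    (hJ : J ∈ 𝓘) (hK : K ∈ 𝓘) (hKS : K ⊆ S) (hS : ∀ x ∈ S, InsertAbsorbs 𝓘 J x) : #K ≤ #J := by
  by_contra! hlt
  obtain ⟨e, heK, heJ, hins⟩ := h.2.2 J hJ K hK hlt
  exact heJ (hS e (hKS heK) hins)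

theorem IsBasisOf.exists_superset {I : Finset (Fin n)} (hI : I ∈ 𝓘) :
    ∃ B, IsBasisOf 𝓘 B ∧ I ⊆ B := by
  obtain ⟨B, hIB, hB⟩ := (Set.toFinite 𝓘).exists_le_maximal hI
  exact ⟨B, ⟨hB.1, fun K hK hBK => (hB.eq_of_le hK hBK).symm⟩, hIB⟩

theorem sum_update_add {ι α : Type*} [Fintype ι] [DecidableEq ι] (g : α → ℕ) (I : ι → α) (j : ι)
    (K : α) : ∑ k, g (Function.update I j K k) + g (I j) = ∑ k, g (I k) + g K := by
  have h1 := Finset.add_sum_erase univ (fun k => g (Function.update I j K k)) (mem_univ j)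
  have h2 := Finset.add_sum_erase univ (fun k => g (I k)) (mem_univ j)
  have h3 : ∑ k ∈ univ.erase j, g (Function.update I j K k) = ∑ k ∈ univ.erase j, g (I k) :=
    sum_congr rfl fun k hk => by rw [Function.update_of_ne (ne_of_mem_erase hk)]
  simp only [Function.update_self] at h1
  omega

/-- The number of members of the family `I` that contain `i`. -/
def memberCount {ℓ : ℕ} (I : Fin ℓ → Finset (Fin n)) (i : Fin n) : ℕ :=
  ∑ j, if i ∈ I j then 1 else 0

theorem sum_memberCount {ℓ : ℕ} (I : Fin ℓ → Finset (Fin n)) (S : Finset (Fin n)) :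
    ∑ i ∈ S, memberCount I i = ∑ j, #(I j ∩ S) := by
  unfold memberCount
  rw [sum_comm]
  refine sum_congr rfl fun j _ => ?_
  rw [← card_filter, filter_mem_eq_inter, inter_comm]

theorem memberCount_update {ℓ : ℕ} (I : Fin ℓ → Finset (Fin n)) (j : Fin ℓ)
    (K : Finset (Fin n)) (i : Fin n) :
    memberCount (Function.update I j K) i + (if i ∈ I j then 1 else 0) =
      memberCount I i + (if i ∈ K then 1 else 0) :=
  sum_update_add (fun J : Finset (Fin n) => if i ∈ J then 1 else 0) I j K

/-- A family of sets together with a surplus element; a step swaps the surplus element into one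
of the sets, and the element it replaces becomes the new surplus element. -/
def ExchangeStep (𝓘 : Set (Finset (Fin n))) {ℓ : ℕ}
    (c c' : (Fin ℓ → Finset (Fin n)) × Fin n) : Prop :=
  ∃ j, ∃ y ∈ c.1 j, c.2 ∉ c.1 j ∧ insert c.2 ((c.1 j).erase y) ∈ 𝓘 ∧
    c' = (Function.update c.1 j (insert c.2 ((c.1 j).erase y)), y)

/-- The family of `c` is an independent packing in `a` of total size `t`, with room left for
the surplus element. -/
def IsPacking (𝓘 : Set (Finset (Fin n))) {ℓ : ℕ} (a : Fin n → ℕ) (t : ℕ)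
    (c : (Fin ℓ → Finset (Fin n)) × Fin n) : Prop :=
  (∀ j, c.1 j ∈ 𝓘) ∧ (∀ i, memberCount c.1 i + (if i = c.2 then 1 else 0) ≤ a i) ∧
    ∑ j, #(c.1 j) = t

theorem IsPacking.step {ℓ : ℕ} {a : Fin n → ℕ} {t : ℕ} {c c' : (Fin ℓ → Finset (Fin n)) × Fin n}
    (hc : IsPacking 𝓘 a t c) (hs : ExchangeStep 𝓘 c c') : IsPacking 𝓘 a t c' := by
  obtain ⟨I, e⟩ := c
  obtain ⟨j, y, hy, he, hins, rfl⟩ := hs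
  obtain ⟨hI, ha, ht⟩ := hc
  simp only at hy he hins hI ha ht
  refine ⟨fun k => ?_, fun i => ?_, ?_⟩
  · by_cases hk : k = j
    · subst hk; simpa using hins
    · simpa [Function.update_of_ne hk] using hI k
  · have h1 := memberCount_update I j (insert e ((I j).erase y)) i
    have h2 := ha i
    have hey : e ≠ y := fun hh => he (hh ▸ hy)
    simp only [mem_insert, mem_erase] at h1
    by_cases hie : i = e
    · subst hie
      simp [he, hey] at h1 h2 ⊢
      omega
    · by_cases hiy : i = y
      · subst hiy
        simp [hy, hie] at h1 h2 ⊢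
        omega
      · simp only [hie, hiy, ne_eq, not_false_eq_true, true_and, false_or] at h1 h2 ⊢
        simp only [if_false] at h2 ⊢
        omega
  · have h1 := sum_update_add card I j (insert e ((I j).erase y))
    rw [card_insert_of_notMem (fun hh => he (mem_of_mem_erase hh)), card_erase_of_mem hy] at h1
    have := card_pos.2 ⟨y, hy⟩
    simp only
    omega

/-- In a packing that cannot be enlarged, there is a set `S` containing the surplus element which
lies in the closure of each member's trace on `S`. -/
theorem IndepSystem.exists_absorbed_set (h : IndepSystem 𝓘) {ℓ : ℕ} {a : Fin n → ℕ} {t : ℕ}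
    (hmax : ∀ I : Fin ℓ → Finset (Fin n), (∀ j, I j ∈ 𝓘) → (∀ i, memberCount I i ≤ a i) →
      ∑ j, #(I j) ≤ t)
    {c : (Fin ℓ → Finset (Fin n)) × Fin n} (hc : IsPacking 𝓘 a t c) :
    ∃ S : Finset (Fin n), c.2 ∈ S ∧ ∀ j, ∀ x ∈ S, InsertAbsorbs 𝓘 (c.1 j ∩ S) x := by
  classical
  let S : Finset (Fin n) :=
    univ.filter fun x => ∃ I, Relation.ReflTransGen (ExchangeStep 𝓘) c (I, x)
  have hmem : ∀ c', Relation.ReflTransGen (ExchangeStep 𝓘) c c' → c'.2 ∈ S := fun c' hc' =>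
    mem_filter.2 ⟨mem_univ _, c'.1, hc'⟩
  have hpack : ∀ c', Relation.ReflTransGen (ExchangeStep 𝓘) c c' → IsPacking 𝓘 a t c' := by
    intro c' hc'
    induction hc' with
    | refl => exact hc
    | tail _ hs ih => exact ih.step hs
  have hdep : ∀ c', Relation.ReflTransGen (ExchangeStep 𝓘) c c' → ∀ j, c'.2 ∉ c'.1 j →
      insert c'.2 (c'.1 j) ∉ 𝓘 := by
    rintro ⟨I, e⟩ hc' j he hins
    obtain ⟨hI, ha, ht⟩ := hpack _ hc'
    simp only at he hins hI ha ht
    have := hmax (Function.update I j (insert e (I j))) (fun k => ?_) (fun i => ?_)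
    · have h1 := sum_update_add card I j (insert e (I j))
      rw [card_insert_of_notMem he] at h1
      omega
    · by_cases hk : k = j
      · subst hk; simpa using hins
      · simpa [Function.update_of_ne hk] using hI k
    · have h1 := memberCount_update I j (insert e (I j)) i
      have h2 := ha i
      by_cases hie : i = e
      · subst hie
        simp [he] at h1 h2
        omega
      · simp only [mem_insert, hie, false_or, if_false] at h1 h2
        omega
  have htrace : ∀ c', Relation.ReflTransGen (ExchangeStep 𝓘) c c' → ∀ j, c'.2 ∉ c'.1 j →
      insert c'.2 (c'.1 j ∩ S) ∉ 𝓘 := fun c' hc' j he =>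
    h.insert_inter_notMem ((hpack c' hc').1 j) he (hdep c' hc' j he) fun y hy hins =>
      hmem _ (hc'.tail ⟨j, y, hy, he, hins, rfl⟩)
  have hinv : ∀ c', Relation.ReflTransGen (ExchangeStep 𝓘) c c' → ∀ j x,
      InsertAbsorbs 𝓘 (c'.1 j ∩ S) x ↔ InsertAbsorbs 𝓘 (c.1 j ∩ S) x := by
    intro c' hc'
    induction hc' with
    | refl => exact fun _ _ => Iff.rfl
    | @tail b c' hb hs ih =>
      intro j x
      rw [← ih]
      have hyS := hmem _ (hb.tail hs)
      have heS := hmem _ hb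
      obtain ⟨k, y, hy, he, hins, rfl⟩ := hs
      by_cases hjk : j = k
      · subst hjk
        simp only [Function.update_self] at hyS ⊢
        have heq : insert b.2 ((b.1 j).erase y) ∩ S = insert b.2 ((b.1 j ∩ S).erase y) := by
          rw [insert_inter_of_mem heS, erase_inter]
        rw [heq]
        refine h.absorbs_exchange_iff (h.2.1 _ ((hpack b hb).1 j) _ inter_subset_left)
          (mem_inter.2 ⟨hy, hyS⟩) (fun hh => he (mem_inter.1 hh).1) (htrace b hb j he) ?_
        rw [← heq]
        exact h.2.1 _ hins _ inter_subset_left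
      · simp only [Function.update_of_ne hjk]
  refine ⟨S, hmem _ .refl, fun j x hx => ?_⟩
  obtain ⟨I, hI⟩ := (mem_filter.1 hx).2
  rw [← hinv _ hI]
  intro hins
  by_contra hxI
  exact htrace _ hI j (fun hh => hxI (mem_inter.2 ⟨hh, hx⟩)) hins

/-- If `p • a` is a sum of indicator vectors of `p * ℓ` independent sets, then `a` is a sum of
indicator vectors of `ℓ` independent sets. -/
theorem IndepSystem.exists_memberCount_eq (h : IndepSystem 𝓘) {a : Fin n → ℕ} {p ℓ : ℕ}
    (hp : 0 < p) (hℓ : 0 < ℓ) {f : Fin (p * ℓ) → Finset (Fin n)} (hf : ∀ j, f j ∈ 𝓘)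
    (hfa : ∀ i, p * a i = memberCount f i) :
    ∃ I : Fin ℓ → Finset (Fin n), (∀ j, I j ∈ 𝓘) ∧ ∀ i, a i = memberCount I i := by
  obtain ⟨I, ⟨hI, hIa⟩, hmax⟩ := Set.exists_max_image
    {I : Fin ℓ → Finset (Fin n) | (∀ j, I j ∈ 𝓘) ∧ ∀ i, memberCount I i ≤ a i}
    (fun I => ∑ j, #(I j)) (Set.toFinite _) ⟨fun _ => ∅, fun _ => h.1, by simp [memberCount]⟩
  refine ⟨I, hI, ?_⟩
  by_contra! hne
  obtain ⟨e, he⟩ := hne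
  have hlt : memberCount I e < a e := lt_of_le_of_ne (hIa e) he.symm
  have hroom : ∀ i, memberCount I i + (if i = e then 1 else 0) ≤ a i := by
    intro i
    split_ifs with hi
    · subst hi; omega
    · exact hIa i
  obtain ⟨S, heS, hS⟩ := h.exists_absorbed_set (fun J hJ hJa => hmax J ⟨hJ, hJa⟩)
    (c := (I, e)) ⟨hI, hroom, rfl⟩
  have hbound : ∀ j, p * ∑ i ∈ S, a i ≤ p * ℓ * #(I j ∩ S) := by
    intro j
    rw [mul_sum, sum_congr rfl fun i _ => hfa i, sum_memberCount]
    refine (sum_le_card_nsmul univ _ #(I j ∩ S) fun k _ => ?_).trans (by simp)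
    exact h.card_le_of_absorbs (h.2.1 _ (hI j) _ inter_subset_left)
      (h.2.1 _ (hf k) _ inter_subset_left) inter_subset_right (hS j)
  have hsum : ℓ * (p * ∑ i ∈ S, a i) ≤ p * ℓ * ∑ j, #(I j ∩ S) := by
    rw [mul_sum univ]
    simpa using card_nsmul_le_sum univ (fun j => p * ℓ * #(I j ∩ S)) _ fun j _ => hbound j
  have hle : ∑ i ∈ S, a i ≤ ∑ j, #(I j ∩ S) := by
    refine le_of_mul_le_mul_left ?_ (Nat.mul_pos hp hℓ)
    calc p * ℓ * ∑ i ∈ S, a i = ℓ * (p * ∑ i ∈ S, a i) := by ring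
      _ ≤ _ := hsum
  rw [← sum_memberCount] at hle
  exact absurd (sum_lt_sum (fun i _ => hIa i) ⟨e, heS, hlt⟩) (not_lt.2 hle)

end

/-- (White) Let `M` be a matroid of rank `d` on `[n]`.  If `a ∈ ℕ^n` has total
degree `ℓ·d` and some positive multiple `p·a` is a sum of indicator vectors of
bases of `M`, then `a` itself is a sum of indicator vectors of bases of `M`.
In particular the basis monomial ring of `M` is normal. -/
theorem basis_monomial_ring_normal
    (n d : ℕ) (𝓘 : Set (Finset (Fin n))) (h𝓘 : IndepSystem 𝓘)
    (hrank : ∀ B, IsBasisOf 𝓘 B → B.card = d)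
    (a : Fin n → ℕ) (ℓ : ℕ) (hdeg : ∑ i, a i = ℓ * d)
    (p : ℕ) (hp : 0 < p)
    (hmem : ∃ (N : ℕ) (f : Fin N → Finset (Fin n)),
      (∀ j, IsBasisOf 𝓘 (f j)) ∧
      ∀ i, p * a i = ∑ j, if i ∈ f j then 1 else 0) :
    ∃ (N : ℕ) (f : Fin N → Finset (Fin n)),
      (∀ j, IsBasisOf 𝓘 (f j)) ∧
      ∀ i, a i = ∑ j, if i ∈ f j then 1 else 0 := by
  have hzero : ∑ i, a i = 0 → ∃ (N : ℕ) (f : Fin N → Finset (Fin n)),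
      (∀ j, IsBasisOf 𝓘 (f j)) ∧ ∀ i, a i = ∑ j, if i ∈ f j then 1 else 0 := fun h0 =>
    ⟨0, Fin.elim0, fun j => j.elim0, fun i => by simpa using sum_eq_zero_iff.1 h0 i (mem_univ i)⟩
  rcases Nat.eq_zero_or_pos d with rfl | hd
  · exact hzero (by simpa using hdeg)
  rcases Nat.eq_zero_or_pos ℓ with rfl | hℓ
  · exact hzero (by simpa using hdeg)
  obtain ⟨N, f, hf, hfa⟩ := hmem
  change ∀ i, p * a i = memberCount f i at hfa
  have hN : N = p * ℓ := by
    refine Nat.eq_of_mul_eq_mul_right hd ?_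
    have h1 := sum_memberCount f univ
    rw [← sum_congr rfl fun i _ => hfa i, ← mul_sum, hdeg] at h1
    simp only [inter_univ, hrank _ (hf _), sum_const, card_univ, Fintype.card_fin,
      smul_eq_mul] at h1
    rw [← h1, mul_assoc]
  subst hN
  obtain ⟨I, hI, hIa⟩ := h𝓘.exists_memberCount_eq hp hℓ (fun j => (hf j).1) hfa
  have hcard : ∀ K ∈ 𝓘, #K ≤ d := fun K hK => by
    obtain ⟨B, hB, hKB⟩ := IsBasisOf.exists_superset hK
    exact hrank B hB ▸ card_le_card hKB
  have htotal : ∑ j, #(I j) = ∑ _j : Fin ℓ, d := by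
    have h1 := sum_memberCount I univ
    rw [← sum_congr rfl fun i _ => hIa i, hdeg] at h1
    simpa using h1.symm
  have heq := (sum_eq_sum_iff_of_le fun j _ => hcard _ (hI j)).1 htotal
  exact ⟨ℓ, I, fun j => ⟨hI j, fun K hK hIK =>
    (eq_of_subset_of_card_le hIK ((hcard K hK).trans (heq j (mem_univ j)).ge)).symm⟩, hIa⟩
end

section
/- Let M be a matroid of rank d on [n] with set of bases 𝓑, and let P ⊆ ℝ^n be the convex hull of the indicator vectors Σ_{j∈B} e_j of the bases B ∈ 𝓑. Then for every b ∈ ℕ, every lattice point a ∈ ℤ^n ∩ bP is a sum of exactly b indicator vectors of bases of M (with repetitions allowed). (Ring-theoretically: the Ehrhart ring A(P) equals the homogeneous subring k[F_M t].) -/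
open Finset Pointwise

section MatroidBases

variable {n b : ℕ} {𝓘 : Set (Finset (Fin n))}

/-- The bases are the independent sets with as many elements as some fixed basis. -/
lemma IndepSystem.isBasisOf_iff (h : IndepSystem 𝓘) {B₀ : Finset (Fin n)}
    (hB₀ : IsBasisOf 𝓘 B₀) (B : Finset (Fin n)) :
    IsBasisOf 𝓘 B ↔ B ∈ 𝓘 ∧ B.card = B₀.card := by
  have card_le : ∀ B, IsBasisOf 𝓘 B → ∀ I ∈ 𝓘, I.card ≤ B.card := by
    intro B hB I hI
    by_contra! hlt
    obtain ⟨e, -, heB, hins⟩ := h.2.2 B hB.1 I hI hlt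
    exact heB (hB.2 _ hins (subset_insert e B) ▸ mem_insert_self e B)
  constructor
  · intro hB
    exact ⟨hB.1, (card_le _ hB₀ _ hB.1).antisymm (card_le _ hB _ hB₀.1)⟩
  · rintro ⟨hB, hcard⟩
    exact ⟨hB, fun I hI hBI =>
      (eq_of_subset_of_card_le hBI (hcard ▸ card_le _ hB₀ I hI)).symm⟩

/-- An independent subset of smaller size can be enlarged, using elements of `J`, to the
size of `J`. -/
lemma IndepSystem.exists_superset_card_eq (h : IndepSystem 𝓘) {I J : Finset (Fin n)}
    (hI : I ∈ 𝓘) (hJ : J ∈ 𝓘) (hIJ : I.card ≤ J.card) :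
    ∃ K ∈ 𝓘, I ⊆ K ∧ K ⊆ I ∪ J ∧ K.card = J.card := by
  induction hm : J.card - I.card generalizing I with
  | zero => exact ⟨I, hI, subset_rfl, subset_union_left, by omega⟩
  | succ m ih =>
    obtain ⟨e, heJ, heI, hins⟩ := h.2.2 I hI J hJ (by omega)
    have hc := card_insert_of_notMem heI
    obtain ⟨K, hK, hIK, hKJ, hcard⟩ := ih hins (by omega) (by omega)
    refine ⟨K, hK, (subset_insert e I).trans hIK, fun x hx => ?_, hcard⟩
    have := hKJ hx
    grind

/-- If the exchange of `v` for `u` and the exchange of `y` for `x` are both possible in a basis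
`B`, but the exchange of `y` for `u` is not, then the first two can be carried out in
succession. -/
lemma IndepSystem.exchange_exchange (h : IndepSystem 𝓘) {B : Finset (Fin n)} {u v x y : Fin n}
    (hu : u ∉ B) (hv : v ∈ B) (huv : insert u (B.erase v) ∈ 𝓘)
    (hx : x ∉ B) (hy : y ∈ B) (hxy : insert x (B.erase y) ∈ 𝓘)
    (huy : insert u (B.erase y) ∉ 𝓘) :
    insert x ((insert u (B.erase v)).erase y) ∈ 𝓘 := by
  have hyv : y ≠ v := by rintro rfl; exact huy huv
  have hyu : y ≠ u := by rintro rfl; exact hu hy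
  have hcard : ((insert u (B.erase v)).erase y).card < (insert x (B.erase y)).card := by
    have h1 : y ∈ insert u (B.erase v) := by simp [*]
    have h2 : u ∉ B.erase v := by simp [*]
    have h3 : x ∉ B.erase y := by simp [*]
    have := card_pos.2 ⟨v, hv⟩
    rw [card_erase_of_mem h1, card_insert_of_notMem h2, card_insert_of_notMem h3,
      card_erase_of_mem hv, card_erase_of_mem hy]
    omega
  obtain ⟨e, he, he', hins⟩ := h.2.2 _ (h.2.1 _ huv _ (erase_subset _ _)) _ hxy hcard
  by_cases hex : e = x
  · rwa [hex] at hins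
  · have hev : e = v := by grind
    refine absurd ?_ huy
    convert hins using 1
    grind

/-- How many members of the family `f` contain `i`. -/
def coverage (f : Fin b → Finset (Fin n)) (i : Fin n) : ℤ :=
  ∑ j, if i ∈ f j then 1 else 0

/-- The element `v` can be replaced by `u` in some member of the family `f` without losing
independence. -/
def CanExchange (𝓘 : Set (Finset (Fin n))) (f : Fin b → Finset (Fin n)) (u v : Fin n) : Prop :=
  ∃ j, u ∉ f j ∧ v ∈ f j ∧ insert u ((f j).erase v) ∈ 𝓘

/-- The total amount by which the coverage of `f` falls short of `a`. -/
def deficit (a : Fin n → ℤ) (f : Fin b → Finset (Fin n)) : ℕ :=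
  ∑ i, (a i - coverage f i).toNat

lemma coverage_update (f : Fin b → Finset (Fin n)) {j : Fin b} {u v : Fin n}
    (hu : u ∉ f j) (hv : v ∈ f j) (i : Fin n) :
    coverage (Function.update f j (insert u ((f j).erase v))) i =
      coverage f i + (if i = u then 1 else 0) - (if i = v then 1 else 0) := by
  unfold coverage
  rw [← add_sum_erase _ _ (mem_univ j),
    ← add_sum_erase univ (fun k => if i ∈ f k then (1 : ℤ) else 0) (mem_univ j)]
  have : ∑ k ∈ univ.erase j, (if i ∈ Function.update f j (insert u ((f j).erase v)) k
      then (1 : ℤ) else 0) = ∑ k ∈ univ.erase j, if i ∈ f k then (1 : ℤ) else 0 := by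
    refine sum_congr rfl fun k hk => ?_
    rw [Function.update_of_ne (ne_of_mem_erase hk)]
  rw [this, Function.update_self]
  grind

lemma sum_coverage (f : Fin b → Finset (Fin n)) (S : Finset (Fin n)) :
    ∑ i ∈ S, coverage f i = ∑ j, ((S ∩ f j).card : ℤ) := by
  unfold coverage
  rw [sum_comm]
  simp

lemma deficit_update_le (a : Fin n → ℤ) (f : Fin b → Finset (Fin n)) {j : Fin b} {u v : Fin n}
    (hu : u ∉ f j) (hv : v ∈ f j) (hdef : coverage f u < a u) :
    deficit a (Function.update f j (insert u ((f j).erase v))) ≤ deficit a f := by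
  have hsum : ∑ i, ((a i - coverage (Function.update f j (insert u ((f j).erase v))) i).toNat +
      if i = u then 1 else 0) ≤ ∑ i, ((a i - coverage f i).toNat + if i = v then 1 else 0) := by
    refine sum_le_sum fun i _ => ?_
    rw [coverage_update f hu hv]
    have huv : u ≠ v := by rintro rfl; exact hu hv
    grind
  simpa [sum_add_distrib, deficit] using hsum

lemma deficit_update_lt (a : Fin n → ℤ) (f : Fin b → Finset (Fin n)) {j : Fin b} {u v : Fin n}
    (hu : u ∉ f j) (hv : v ∈ f j) (hdef : coverage f u < a u) (hexc : a v < coverage f v) :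
    deficit a (Function.update f j (insert u ((f j).erase v))) < deficit a f := by
  have hsum : ∑ i, ((a i - coverage (Function.update f j (insert u ((f j).erase v))) i).toNat +
      if i = u then 1 else 0) ≤ ∑ i, (a i - coverage f i).toNat := by
    refine sum_le_sum fun i _ => ?_
    rw [coverage_update f hu hv]
    have huv : u ≠ v := by rintro rfl; exact hu hv
    grind
  rw [sum_add_distrib] at hsum
  simp only [sum_ite_eq', mem_univ, if_true] at hsum
  exact hsum

/-- A chain of exchanges from an insufficiently covered element to an excessively covered one
allows the deficit to be decreased. -/
lemma IndepSystem.exists_deficit_lt (h : IndepSystem 𝓘) {d : ℕ} (a : Fin n → ℤ) (k : ℕ)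
    (f : Fin b → Finset (Fin n)) (hf : ∀ j, f j ∈ 𝓘 ∧ (f j).card = d) (p : ℕ → Fin n)
    (hp : ∀ i < k, CanExchange 𝓘 f (p i) (p (i + 1)))
    (hdef : coverage f (p 0) < a (p 0)) (hexc : a (p k) < coverage f (p k)) :
    ∃ g : Fin b → Finset (Fin n), (∀ j, g j ∈ 𝓘 ∧ (g j).card = d) ∧
      deficit a g < deficit a f := by
  induction k using Nat.strong_induction_on generalizing f p with
  | _ k ih =>
  obtain _ | k := k
  · omega
  obtain ⟨j, hu, hv, huv⟩ := hp 0 (by omega)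
  simp only [zero_add] at hv huv
  by_cases hshort : ∃ i, 1 ≤ i ∧ i < k + 1 ∧ CanExchange 𝓘 f (p 0) (p (i + 1))
  · obtain ⟨i, hi1, hik, hex⟩ := hshort
    refine ih (k + 1 - i) (by omega) f hf (fun m => if m = 0 then p 0 else p (m + i)) ?_
      (by simpa using hdef) ?_
    · intro m hm
      obtain rfl | hm0 := Nat.eq_zero_or_pos m
      · simpa [add_comm] using hex
      · have := hp (m + i) (by omega)
        simpa [hm0.ne', add_right_comm] using this
    · have : k + 1 - i + i = k + 1 := by omega
      simpa [this, Nat.sub_eq_zero_iff_le, not_le.2 hik] using hexc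
  push Not at hshort
  set g := Function.update f j (insert (p 0) ((f j).erase (p 1))) with hg
  have hgB : ∀ i, g i ∈ 𝓘 ∧ (g i).card = d := by
    intro i
    by_cases hij : i = j
    · subst hij
      have : p 0 ∉ (f i).erase (p 1) := by simp [hu]
      have hpos := card_pos.2 ⟨_, hv⟩
      rw [hg, Function.update_self, card_insert_of_notMem this, card_erase_of_mem hv]
      have := (hf i).2
      exact ⟨huv, by omega⟩
    · rw [hg, Function.update_of_ne hij]
      exact hf i
  by_cases hexc₁ : a (p 1) < coverage f (p 1)
  · exact ⟨g, hgB, deficit_update_lt a f hu hv hdef hexc₁⟩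
  have hne : p (k + 1) ≠ p 1 := fun h => hexc₁ (h ▸ hexc)
  have hne₀ : p 1 ≠ p 0 := fun h => hu (h ▸ hv)
  have hp' : ∀ i < k, CanExchange 𝓘 g (p (i + 1)) (p (i + 1 + 1)) := by
    intro i hi
    obtain ⟨j', hx, hy, hxy⟩ := hp (i + 1) (by omega)
    refine ⟨j', ?_⟩
    by_cases hj : j' = j
    · subst hj
      have huy : insert (p 0) ((f j').erase (p (i + 1 + 1))) ∉ 𝓘 := fun hmem =>
        hshort (i + 1) (by omega) (by omega) ⟨j', hu, hy, hmem⟩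
      have hx0 : p (i + 1) ≠ p 0 := fun h => huy (h ▸ hxy)
      have hy1 : p (i + 1 + 1) ≠ p 1 := fun h => huy (h ▸ huv)
      rw [hg, Function.update_self]
      exact ⟨by simp [hx0, hx], by simp [hy1, hy], h.exchange_exchange hu hv huv hx hy hxy huy⟩
    · rw [hg, Function.update_of_ne hj]
      exact ⟨hx, hy, hxy⟩
  have hdef' : coverage g (p 1) < a (p 1) := by
    rw [hg, coverage_update f hu hv]
    simp only [hne₀, if_true, if_false]
    omega
  have hexc' : a (p (k + 1)) < coverage g (p (k + 1)) := by
    rw [hg, coverage_update f hu hv, if_neg hne]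
    split_ifs <;> omega
  obtain ⟨g', hg', hlt⟩ := ih k (by omega) g hgB (fun m => p (m + 1)) hp' hdef' hexc'
  exact ⟨g', hg', hlt.trans_le (deficit_update_le a f hu hv hdef)⟩

/-- If no exchange leads from `S` to its complement, every member of the family meets `S` in as
many elements as possible. -/
lemma IndepSystem.card_inter_le (h : IndepSystem 𝓘) {f : Fin b → Finset (Fin n)} {d : ℕ}
    (hf : ∀ j, f j ∈ 𝓘 ∧ (f j).card = d) {S : Finset (Fin n)}
    (hS : ∀ u ∈ S, ∀ v, CanExchange 𝓘 f u v → v ∈ S) {B : Finset (Fin n)}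
    (hB : B ∈ 𝓘 ∧ B.card = d) (j : Fin b) : (S ∩ B).card ≤ (S ∩ f j).card := by
  by_contra! hlt
  obtain ⟨hj, hjd⟩ := hf j
  obtain ⟨e, he, he', hins⟩ := h.2.2 _ (h.2.1 _ hj _ inter_subset_right) _
    (h.2.1 _ hB.1 _ inter_subset_right) hlt
  obtain ⟨heS, -⟩ := mem_inter.1 he
  have hef : e ∉ f j := fun hmem => he' (mem_inter.2 ⟨heS, hmem⟩)
  have hle : (insert e (S ∩ f j)).card ≤ (f j).card := by
    rw [card_insert_of_notMem he', hjd, ← hB.2]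
    exact hlt.trans_le (card_le_card inter_subset_right)
  obtain ⟨K, hK, hIK, hKJ, hcard⟩ := h.exists_superset_card_eq hins hj hle
  have heK : e ∈ K := hIK (mem_insert_self _ _)
  obtain ⟨v, hv, hvK⟩ : ∃ v ∈ f j, v ∉ K := by
    by_contra! hsub
    have := card_le_card (insert_subset heK hsub)
    rw [card_insert_of_notMem hef] at this
    omega
  have hKeq : K = insert e ((f j).erase v) := by
    refine eq_of_subset_of_card_le (fun x hx => ?_) ?_
    · have := hKJ hx
      grind
    · have := card_pos.2 ⟨v, hv⟩
      rw [card_insert_of_notMem (by simp [hef]), card_erase_of_mem hv]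
      omega
  have hvS : v ∈ S := hS e heS v ⟨j, hef, hv, hKeq ▸ hK⟩
  exact hvK (hIK (mem_insert_of_mem (mem_inter.2 ⟨hvS, hv⟩)))

/-- Coordinate sums over `S` on the convex hull of the indicator vectors of bases lie in every
convex set that contains the numbers `|S ∩ B|`. -/
lemma sum_mem_of_mem_convexHull {x : Fin n → ℝ}
    (hx : x ∈ convexHull ℝ {x : Fin n → ℝ |
      ∃ B, IsBasisOf 𝓘 B ∧ x = fun i => if i ∈ B then 1 else 0})
    (S : Finset (Fin n)) {C : Set ℝ} (hC : Convex ℝ C)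
    (hS : ∀ B, IsBasisOf 𝓘 B → ((S ∩ B).card : ℝ) ∈ C) : ∑ i ∈ S, x i ∈ C := by
  let φ : (Fin n → ℝ) →ₗ[ℝ] ℝ := ∑ i ∈ S, LinearMap.proj i
  have hφ : ∀ y, φ y = ∑ i ∈ S, y i := fun y => by simp [φ]
  rw [← hφ]
  refine convexHull_min ?_ (hC.linear_preimage φ) hx
  rintro _ ⟨B, hB, rfl⟩
  simpa [hφ] using hS B hB

/-- A family of bases of minimal deficit with respect to a lattice point `a` of the dilated basis
polytope covers every element at least as often as `a` prescribes. -/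
lemma IndepSystem.le_coverage (h : IndepSystem 𝓘) {d : ℕ}
    (hd : ∀ B, IsBasisOf 𝓘 B ↔ B ∈ 𝓘 ∧ B.card = d) {a : Fin n → ℤ}
    {f : Fin b → Finset (Fin n)} (hf : ∀ j, f j ∈ 𝓘 ∧ (f j).card = d)
    (hmin : ∀ g : Fin b → Finset (Fin n), (∀ j, g j ∈ 𝓘 ∧ (g j).card = d) →
      deficit a f ≤ deficit a g) {x : Fin n → ℝ}
    (hx : x ∈ convexHull ℝ {x : Fin n → ℝ |
      ∃ B, IsBasisOf 𝓘 B ∧ x = fun i => if i ∈ B then 1 else 0})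
    (hax : ∀ i, (a i : ℝ) = b * x i) (u : Fin n) : a u ≤ coverage f u := by
  classical
  by_contra! hu
  let S : Finset (Fin n) := {v | ∃ k, ∃ p : ℕ → Fin n, p 0 = u ∧ p k = v ∧
    ∀ i < k, CanExchange 𝓘 f (p i) (p (i + 1))}
  have huS : u ∈ S := by
    simp only [S, mem_filter_univ]
    exact ⟨0, fun _ => u, rfl, rfl, by simp⟩
  have hS : ∀ v ∈ S, ∀ w, CanExchange 𝓘 f v w → w ∈ S := by
    intro v hv w hvw
    simp only [S, mem_filter_univ] at hv ⊢
    obtain ⟨k, p, hp0, hpk, hp⟩ := hv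
    refine ⟨k + 1, fun i => if i ≤ k then p i else w, by simpa using hp0, by simp, ?_⟩
    intro i hi
    obtain hik | rfl := Nat.lt_succ_iff_lt_or_eq.1 hi
    · simpa [hik.le, Nat.succ_le_of_lt hik] using hp i hik
    · simpa [hpk] using hvw
  have hle : ∀ v ∈ S, coverage f v ≤ a v := by
    intro v hv
    by_contra! hexc
    simp only [S, mem_filter_univ] at hv
    obtain ⟨k, p, rfl, rfl, hp⟩ := hv
    obtain ⟨g, hg, hlt⟩ := h.exists_deficit_lt a k f hf p hp hu hexc
    exact hlt.not_ge (hmin g hg)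
  have hlt : ∑ v ∈ S, coverage f v < ∑ v ∈ S, a v := sum_lt_sum hle ⟨u, huS, hu⟩
  refine hlt.not_ge ?_
  have hxS : ∀ j, ∑ v ∈ S, x v ≤ ((S ∩ f j).card : ℝ) := fun j =>
    sum_mem_of_mem_convexHull hx S (convex_Iic _) fun B hB =>
      Set.mem_Iic.2 (Nat.cast_le.2 (h.card_inter_le hf hS ((hd B).1 hB) j))
  have hreal : ((∑ v ∈ S, a v : ℤ) : ℝ) ≤ ((∑ v ∈ S, coverage f v : ℤ) : ℝ) := by
    rw [sum_coverage]
    push_cast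
    calc ∑ v ∈ S, (a v : ℝ) = ∑ _j : Fin b, ∑ v ∈ S, x v := by simp [hax, mul_sum]
      _ ≤ _ := sum_le_sum fun j _ => hxS j
  exact_mod_cast hreal

end MatroidBases

/-- Let `M` be a matroid of rank `d` on `[n]` and let `P` be the convex hull of
the indicator vectors of the bases of `M`.  Then for every `b ∈ ℕ`, every lattice
point of `bP` is a sum of exactly `b` indicator vectors of bases of `M`.
(Ring-theoretically: the Ehrhart ring `A(P)` equals `k[F_M t]`.) -/
theorem ehrhart_ring_eq_basis_subring
    (n d : ℕ) (𝓘 : Set (Finset (Fin n))) (h𝓘 : IndepSystem 𝓘)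
    (hrank : ∀ B, IsBasisOf 𝓘 B → B.card = d)
    (b : ℕ) (a : Fin n → ℤ)
    (ha : (fun i => (a i : ℝ)) ∈ (b : ℝ) •
      convexHull ℝ {x : Fin n → ℝ |
        ∃ B, IsBasisOf 𝓘 B ∧ x = fun i => if i ∈ B then 1 else 0}) :
    ∃ f : Fin b → Finset (Fin n),
      (∀ j, IsBasisOf 𝓘 (f j)) ∧
      ∀ i, a i = ∑ j, if i ∈ f j then 1 else 0 := by
  obtain ⟨x, hx, hxa⟩ := ha
  have hax : ∀ i, (a i : ℝ) = b * x i := fun i => (congrFun hxa i).symm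
  obtain ⟨_, B₀, hB₀, -⟩ := convexHull_nonempty_iff.1 ⟨x, hx⟩
  have hd : ∀ B, IsBasisOf 𝓘 B ↔ B ∈ 𝓘 ∧ B.card = d := hrank B₀ hB₀ ▸ h𝓘.isBasisOf_iff hB₀
  obtain ⟨f, hf, hmin⟩ := (InvImage.wf (deficit a) Nat.lt_wfRel.wf).has_min
    {f : Fin b → Finset (Fin n) | ∀ j, f j ∈ 𝓘 ∧ (f j).card = d}
    ⟨fun _ => B₀, fun _ => (hd B₀).1 hB₀⟩
  replace hmin : ∀ g : Fin b → Finset (Fin n), (∀ j, g j ∈ 𝓘 ∧ (g j).card = d) →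
      deficit a f ≤ deficit a g := fun g hg => not_lt.1 (hmin g hg)
  have hle := h𝓘.le_coverage hd hf hmin hx hax
  have hsum : ∑ i, a i = ∑ i, coverage f i := by
    have hxd : ∑ i, x i = d := sum_mem_of_mem_convexHull hx univ (convex_singleton (d : ℝ))
      fun B hB => by simp [hrank B hB]
    have hreal : ((∑ i, a i : ℤ) : ℝ) = ((∑ i, coverage f i : ℤ) : ℝ) := by
      rw [sum_coverage]
      simp [hax, ← mul_sum, hxd, fun j => (hf j).2]
    exact_mod_cast hreal
  exact ⟨f, fun j => (hd _).2 (hf j), fun i =>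
    (sum_eq_sum_iff_of_le fun i _ => hle i).1 hsum i (mem_univ i)⟩
end

section
/- Let 𝒜 = {v_1,…,v_q} ⊆ ℕ^n be the set of bases of a discrete polymatroid of rank d, i.e., |v_i| = d for all i and the exchange property holds: for all a, c ∈ 𝒜 and every index i with a_i > c_i there exists an index j with a_j < c_j such that a − e_i + e_j ∈ 𝒜. Assume some element of 𝒜 has positive first coordinate. Then the set 𝒜₁ = {v − e_1 : v ∈ 𝒜, v_1 ≥ 1} also satisfies the exchange property (and all its elements have modulus d − 1); that is, 𝒜₁ is the set of bases of a discrete polymatroid of rank d − 1. (Monomial formulation: if F = {x^{v_1},…,x^{v_q}} is a polymatroidal set of monomials, then F' = {x^{v_i}/x_1 : x_1 occurs in x^{v_i}} is also polymatroidal.) -/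
open Finset

/-- A nonempty finite set `𝒜 ⊆ ℕ^n` is the set of bases of a discrete polymatroid
of rank `d` if every element has modulus `d` and the exchange property holds:
for `a, c ∈ 𝒜` with `a i > c i` there is `j` with `a j < c j` and
`a - e_i + e_j ∈ 𝒜`. -/
def PolymatroidBases {n : ℕ} (𝒜 : Finset (Fin n → ℕ)) (d : ℕ) : Prop :=
  𝒜.Nonempty ∧
  (∀ v ∈ 𝒜, ∑ i, v i = d) ∧
  (∀ a ∈ 𝒜, ∀ c ∈ 𝒜, ∀ i, c i < a i →
    ∃ j, a j < c j ∧ a + Pi.single j 1 - Pi.single i 1 ∈ 𝒜)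

/-- If `𝒜` is the set of bases of a discrete polymatroid of rank `d` and some
element of `𝒜` has positive first coordinate, then
`𝒜₁ = {v - e_1 : v ∈ 𝒜, v_1 ≥ 1}` is the set of bases of a discrete polymatroid
of rank `d - 1`.  (Monomial formulation: if `F` is a polymatroidal set of
monomials then `F' = {x^{v}/x_1 : x_1 divides x^{v}}` is also polymatroidal.) -/
theorem polymatroid_quotient_polymatroidal
    (n d : ℕ) (hn : 0 < n) (𝒜 : Finset (Fin n → ℕ))
    (h𝒜 : PolymatroidBases 𝒜 d)
    (hx : ∃ v ∈ 𝒜, 0 < v ⟨0, hn⟩) :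
    PolymatroidBases
      ((𝒜.filter fun v => 0 < v ⟨0, hn⟩).image
        fun v => v - Pi.single (⟨0, hn⟩ : Fin n) 1) (d - 1) := by
  obtain ⟨-, hsum, hex⟩ := h𝒜
  obtain ⟨v₀, hv₀, hpos₀⟩ := hx
  refine ⟨⟨_, mem_image_of_mem _ (mem_filter.2 ⟨hv₀, hpos₀⟩)⟩, ?_, ?_⟩
  · intro w hw
    obtain ⟨v, hv, rfl⟩ := mem_image.1 hw
    obtain ⟨hv, hpos⟩ := mem_filter.1 hv
    have hle : Pi.single (⟨0, hn⟩ : Fin n) 1 ≤ v := by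
      intro k
      by_cases hk : k = ⟨0, hn⟩
      · subst hk
        simpa only [Pi.single_eq_same] using Nat.succ_le_of_lt hpos
      · simp [hk]
    simp only [Pi.sub_apply]
    rw [sum_tsub_distrib _ fun k _ => hle k, hsum v hv]
    simp
  · intro a' ha' c' hc' i hi
    obtain ⟨a, ha, rfl⟩ := mem_image.1 ha'
    obtain ⟨c, hc, rfl⟩ := mem_image.1 hc'
    obtain ⟨ha, ha0⟩ := mem_filter.1 ha
    obtain ⟨hc, hc0⟩ := mem_filter.1 hc
    simp only [Pi.sub_apply] at hi
    obtain ⟨j, hj, hb⟩ := hex a ha c hc i (by omega)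
    refine ⟨j, ?_, mem_image.2 ⟨_, mem_filter.2 ⟨hb, ?_⟩, ?_⟩⟩
    · by_cases h : j = ⟨0, hn⟩
      · subst h
        simp only [Pi.sub_apply, Pi.single_eq_same]
        omega
      · simpa [h] using hj
    · by_cases h : i = ⟨0, hn⟩
      · subst h
        simp only [Pi.add_apply, Pi.sub_apply, Pi.single_eq_same] at hi ⊢
        omega
      · have h' : (⟨0, hn⟩ : Fin n) ≠ i := Ne.symm h
        simp only [Pi.add_apply, Pi.sub_apply, Pi.single_eq_of_ne h']
        omega
    · ext k
      by_cases h : k = ⟨0, hn⟩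
      · subst h
        simp only [Pi.add_apply, Pi.sub_apply, Pi.single_eq_same]
        omega
      · simp [h]
end

section
/- Let u_1,…,u_s ∈ ℕ^n, let d = max{|u_i| : i ∈ [s]}, and suppose u_1,…,u_t (t ≤ s) are exactly those u_i with |u_i| = d. Let Q = conv(u_1,…,u_s) and P = conv(u_1,…,u_t) in ℝ^n. If for every b ∈ ℕ every lattice point a ∈ ℤ^n ∩ bQ is a sum of exactly b elements of {u_1,…,u_s} (with repetitions allowed), then for every b ∈ ℕ every lattice point a ∈ ℤ^n ∩ bP is a sum of exactly b elements of {u_1,…,u_t}. (Ring-theoretically: if k[Gt] = A(Q) for G = {x^{u_1},…,x^{u_s}}, then k[Ft] = A(P) for F = {x^{u_1},…,x^{u_t}}.) -/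
open Finset Pointwise

/-- Let `u_1, …, u_s ∈ ℕ^n`, let `d = max_i |u_i|`, and suppose `u_1, …, u_t`
are exactly the `u_i` of modulus `d`.  Let `Q = conv(u_1, …, u_s)` and
`P = conv(u_1, …, u_t)`.  If for every `b ∈ ℕ` each lattice point of `bQ` is a
sum of exactly `b` of the vectors `u_1, …, u_s`, then for every `b ∈ ℕ` each
lattice point of `bP` is a sum of exactly `b` of the vectors `u_1, …, u_t`.
(Ring-theoretically: if `k[Gt] = A(Q)` then `k[Ft] = A(P)`.) -/
theorem top_degree_ehrhart_ring
    (n s t d : ℕ) (hs : 0 < s) (hts : t ≤ s)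
    (u : Fin s → Fin n → ℕ)
    (hd : d = Finset.univ.sup fun i : Fin s => ∑ j, u i j)
    (ht : ∀ i : Fin s, (i : ℕ) < t ↔ ∑ j, u i j = d)
    (hQ : ∀ (b : ℕ) (a : Fin n → ℤ),
      (fun j => (a j : ℝ)) ∈ (b : ℝ) •
        convexHull ℝ (Set.range fun i : Fin s => fun j : Fin n => (u i j : ℝ)) →
      ∃ f : Fin b → Fin s, ∀ j, a j = ∑ k, (u (f k) j : ℤ)) :
    ∀ (b : ℕ) (a : Fin n → ℤ),
      (fun j => (a j : ℝ)) ∈ (b : ℝ) •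
        convexHull ℝ {x : Fin n → ℝ |
          ∃ i : Fin s, (i : ℕ) < t ∧ x = fun j => (u i j : ℝ)} →
      ∃ f : Fin b → Fin s, (∀ k, ((f k : ℕ) < t)) ∧
        ∀ j, a j = ∑ k, (u (f k) j : ℤ) := by
  rintro b a ⟨x, hx, hxa⟩
  have hsum : ∑ j, x j = d := by
    have hconv : Convex ℝ {y : Fin n → ℝ | ∑ j, y j = d} := by
      intro y hy z hz α β _ _ hαβ
      simp only [Set.mem_ofPred_eq, Pi.add_apply, Pi.smul_apply, smul_eq_mul,
        Finset.sum_add_distrib, ← Finset.mul_sum] at hy hz ⊢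
      rw [hy, hz, ← add_mul, hαβ, one_mul]
    refine convexHull_min ?_ hconv hx
    rintro _ ⟨i, hi, rfl⟩
    change ∑ j, (u i j : ℝ) = d
    exact_mod_cast (ht i).1 hi
  have ha : ∑ j, a j = (b : ℤ) * d := by
    have hreal : ∑ j, (a j : ℝ) = b * d := by
      rw [← hsum, Finset.mul_sum]
      exact Finset.sum_congr rfl fun j _ => (congrFun hxa j).symm
    exact_mod_cast hreal
  obtain ⟨f, hf⟩ := hQ b a ⟨x, convexHull_mono (by
    rintro _ ⟨i, _, rfl⟩
    exact ⟨i, rfl⟩) hx, hxa⟩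
  have hle : ∀ k ∈ Finset.univ, ∑ j, u (f k) j ≤ d := fun k _ => by
    rw [hd]
    exact Finset.le_sup (f := fun i : Fin s => ∑ j, u i j) (Finset.mem_univ (f k))
  have htotal : ∑ k, ∑ j, u (f k) j = ∑ _k : Fin b, d := by
    simp only [hf] at ha
    rw [Finset.sum_comm] at ha
    rw [Finset.sum_const, Finset.card_univ, Fintype.card_fin, smul_eq_mul]
    exact_mod_cast ha
  exact ⟨f, fun k => (ht _).2 ((Finset.sum_eq_sum_iff_of_le hle).1 htotal k (Finset.mem_univ k)), hf⟩
end

section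
/- Let 𝒜 = {v_1,…,v_q} ⊆ ℕ^n be the set of bases of a discrete polymatroid of rank d, and let 𝒜' = {e_1,…,e_n, (v_1,1),…,(v_q,1)} ⊆ ℝ^{n+1}. Then 𝒜' is an integral Hilbert basis: ℤ^{n+1} ∩ ℝ_+𝒜' = ℕ𝒜', i.e., every lattice point of the Rees cone ℝ_+𝒜' is a nonnegative integer combination of elements of 𝒜'. (Ring-theoretically: the Rees algebra R[It] of the polymatroidal ideal I = (x^{v_1},…,x^{v_q}) is normal.) -/
open Finset

/-- The integral version of the generators of the Rees cone. -/
def reesGenZ (n q : ℕ) (v : Fin q → Fin n → ℕ) :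
    Fin n ⊕ Fin q → (Fin (n + 1) → ℤ)
  | Sum.inl i => Pi.single i.castSucc 1
  | Sum.inr j => Fin.snoc (fun i => (v j i : ℤ)) 1

/-- The exchange property of the bases of a discrete polymatroid, for a family of integer
vectors. -/
def ExchangeFamily {ι κ : Type*} [DecidableEq ι] (w : κ → ι → ℤ) : Prop :=
  ∀ j j' i, w j' i < w j i →
    ∃ l, w j l < w j' l ∧ ∃ j'', w j'' = w j + Pi.single l 1 - Pi.single i 1

/-- The smallest sum over `S` attained by a member of the family `w`. -/
def minSum {ι κ : Type*} [Fintype κ] [Nonempty κ] (w : κ → ι → ℤ) (S : Finset ι) : ℤ :=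
  univ.inf' univ_nonempty fun j => ∑ i ∈ S, w j i

section MinSum

variable {ι κ : Type*} [Fintype κ] [Nonempty κ] (w : κ → ι → ℤ)

lemma minSum_le (S : Finset ι) (j : κ) : minSum w S ≤ ∑ i ∈ S, w j i :=
  inf'_le _ (mem_univ j)

lemma exists_eq_minSum (S : Finset ι) : ∃ j, ∑ i ∈ S, w j i = minSum w S := by
  obtain ⟨j, -, hj⟩ := exists_mem_eq_inf' (univ_nonempty (α := κ)) fun j => ∑ i ∈ S, w j i
  exact ⟨j, hj.symm⟩

lemma minSum_empty : minSum w ∅ = 0 := by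
  obtain ⟨j, hj⟩ := exists_eq_minSum w ∅
  simpa using hj.symm

end MinSum

lemma sum_exchange {ι : Type*} [DecidableEq ι] (a : ι → ℤ) (l i : ι) (S : Finset ι) :
    ∑ m ∈ S, (a + Pi.single l 1 - Pi.single i 1 : ι → ℤ) m =
      ∑ m ∈ S, a m + (if l ∈ S then 1 else 0) - (if i ∈ S then 1 else 0) := by
  simp [sum_add_distrib, sum_sub_distrib]

/-- The discrete sandwich theorem: between an integral supermodular and an integral submodular
set function there is an integral modular one. -/
lemma exists_sum_between {ι : Type*} [Fintype ι] [DecidableEq ι] (V : Finset ι) :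
    ∀ f g : Finset ι → ℤ, (∀ S T, f S + f T ≤ f (S ∪ T) + f (S ∩ T)) →
      (∀ S T, g (S ∪ T) + g (S ∩ T) ≤ g S + g T) → (∀ S, f S ≤ g S) → f ∅ = 0 → g ∅ = 0 →
      ∃ a : ι → ℤ, ∀ S ⊆ V, f S ≤ ∑ i ∈ S, a i ∧ ∑ i ∈ S, a i ≤ g S := by
  induction V using Finset.induction_on with
  | empty =>
    intro f g _ _ _ hf0 hg0
    refine ⟨0, fun S hS => ?_⟩
    rw [subset_empty.mp hS]
    simp [hf0, hg0]
  | insert e V he ih =>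
    intro f g hf hg hfg hf0 hg0
    obtain ⟨S₀, -, hS₀⟩ := exists_max_image (univ : Finset (Finset ι))
      (fun S => f (insert e S) - g (S.erase e)) univ_nonempty
    obtain ⟨t, ht⟩ : ∃ t, t = f (insert e S₀) - g (S₀.erase e) := ⟨_, rfl⟩
    have hlow : ∀ S, f (insert e S) - t ≤ g (S.erase e) := fun S => by
      have := hS₀ S (mem_univ S)
      omega
    have hu (S T : Finset ι) : insert e S ∪ T.erase e = insert e (S ∪ T) := by
      ext x; by_cases hx : x = e <;> simp [hx]
    have hi (S T : Finset ι) : insert e S ∩ T.erase e = (S ∩ T).erase e := by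
      ext x; by_cases hx : x = e <;> simp [hx]
    have hui (S T : Finset ι) : insert e S ∪ insert e T = insert e (S ∪ T) := by
      ext x; by_cases hx : x = e <;> simp [hx]
    have hii (S T : Finset ι) : insert e S ∩ insert e T = insert e (S ∩ T) := by
      ext x; by_cases hx : x = e <;> simp [hx]
    have hue (S T : Finset ι) : S.erase e ∪ T.erase e = (S ∪ T).erase e := by
      ext x; by_cases hx : x = e <;> simp [hx]
    have hie (S T : Finset ι) : S.erase e ∩ T.erase e = (S ∩ T).erase e := by
      ext x; by_cases hx : x = e <;> simp [hx]
    have hupp : ∀ S, f (S.erase e) ≤ g (insert e S) - t := fun S => by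
      have h1 := hf (insert e S₀) (S.erase e)
      have h2 := hg (insert e S) (S₀.erase e)
      rw [hu, hi] at h1 h2
      rw [union_comm S, inter_comm S] at h2
      have h3 := hfg (insert e (S₀ ∪ S))
      have h4 := hfg ((S₀ ∩ S).erase e)
      omega
    have hlow0 := hlow ∅
    have hupp0 := hupp ∅
    simp only [erase_empty, hf0, hg0] at hlow0 hupp0
    obtain ⟨a, ha⟩ := ih (fun S => max (f (S.erase e)) (f (insert e S) - t))
      (fun S => min (g (S.erase e)) (g (insert e S) - t))
      (fun S T => by
        have h1 := hf (S.erase e) (T.erase e)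
        have h2 := hf (insert e S) (T.erase e)
        have h3 := hf (insert e T) (S.erase e)
        have h4 := hf (insert e S) (insert e T)
        rw [hue, hie] at h1
        rw [hu, hi] at h2 h3
        rw [union_comm T, inter_comm T] at h3
        rw [hui, hii] at h4
        omega)
      (fun S T => by
        have h1 := hg (S.erase e) (T.erase e)
        have h2 := hg (insert e S) (T.erase e)
        have h3 := hg (insert e T) (S.erase e)
        have h4 := hg (insert e S) (insert e T)
        rw [hue, hie] at h1
        rw [hu, hi] at h2 h3
        rw [union_comm T, inter_comm T] at h3
        rw [hui, hii] at h4
        omega)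
      (fun S => by
        have h1 := hfg (S.erase e)
        have h2 := hfg (insert e S)
        have h3 := hlow S
        have h4 := hupp S
        omega)
      (by simp only [erase_empty, hf0]; omega)
      (by simp only [erase_empty, hg0]; omega)
    refine ⟨Function.update a e t, fun S hS => ?_⟩
    have haS := ha (S.erase e) (subset_insert_iff.mp hS)
    have hins : insert e (S.erase e) = insert e S := by
      ext x; by_cases hx : x = e <;> simp [hx]
    simp only [erase_idem, hins] at haS
    have hsum : ∑ i ∈ S.erase e, Function.update a e t i = ∑ i ∈ S.erase e, a i :=
      sum_congr rfl fun i hi => Function.update_of_ne (ne_of_mem_erase hi) _ _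
    by_cases heS : e ∈ S
    · have := add_sum_erase S (Function.update a e t) heS
      rw [hsum, Function.update_self] at this
      rw [insert_eq_of_mem heS] at haS
      omega
    · rw [erase_eq_of_notMem heS] at haS hsum
      rw [hsum]
      omega

namespace ExchangeFamily

/-- Bounding one coordinate from above preserves the exchange property. -/
lemma subtype_le {ι κ : Type*} [DecidableEq ι] {w : κ → ι → ℤ} (hw : ExchangeFamily w)
    (e : ι) (t : ℤ) :
    ExchangeFamily fun j : {j // w j e ≤ t} => w j := by
  rintro ⟨j, hj⟩ ⟨c, hc⟩ i hi
  obtain ⟨l, hl, j', hj'⟩ := hw j c i hi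
  have hli : l ≠ i := by rintro rfl; exact lt_asymm hl hi
  refine ⟨l, hl, ⟨j', ?_⟩, hj'⟩
  rw [hj']
  by_cases hel : e = l
  · subst hel
    simp only [Pi.sub_apply, Pi.add_apply, Pi.single_eq_same, Pi.single_eq_of_ne hli]
    omega
  · by_cases hei : e = i
    · subst hei
      simp only [Pi.sub_apply, Pi.add_apply, Pi.single_eq_same, Pi.single_eq_of_ne hel]
      omega
    · simpa [hel, hei] using hj

variable {ι κ : Type*} [Fintype ι] [DecidableEq ι] [Fintype κ] [Nonempty κ] {w : κ → ι → ℤ}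

/-- Nested sets are minimized simultaneously by one member of the family. -/
lemma exists_eq_minSum_of_subset (hw : ExchangeFamily w) {P Q : Finset ι} (hPQ : P ⊆ Q) :
    ∃ j, ∑ i ∈ P, w j i = minSum w P ∧ ∑ i ∈ Q, w j i = minSum w Q := by
  obtain ⟨c, hc⟩ := exists_eq_minSum w P
  obtain ⟨j₀, hj₀⟩ := exists_eq_minSum w Q
  obtain ⟨j, hj, hmin⟩ := exists_min_image
    (univ.filter fun j => ∑ i ∈ Q, w j i = minSum w Q)
    (fun j => ∑ i, max (w j i - w c i) 0) ⟨j₀, by simpa using hj₀⟩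
  rw [mem_filter_univ] at hj
  refine ⟨j, ?_, hj⟩
  by_contra hne
  have hlt : ∑ i ∈ P, w c i < ∑ i ∈ P, w j i := by
    rw [hc]
    exact lt_of_le_of_ne (minSum_le w P j) (Ne.symm hne)
  obtain ⟨i, hiP, hi⟩ := exists_lt_of_sum_lt hlt
  obtain ⟨l, hl, j', hj'⟩ := hw j c i hi
  have hQ := sum_exchange (w j) l i Q
  rw [← hj', if_pos (hPQ hiP)] at hQ
  have hQ' := minSum_le w Q j'
  have hmem : ∑ i ∈ Q, w j' i = minSum w Q := by
    split_ifs at hQ <;> omega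
  refine absurd (hmin j' (by simpa using hmem)) (not_le.mpr ?_)
  have hli : l ≠ i := by rintro rfl; omega
  refine sum_lt_sum (fun m _ => ?_) ⟨i, mem_univ i, ?_⟩
  · rw [hj']
    by_cases hml : m = l
    · subst hml
      simp [hli]
      omega
    · by_cases hmi : m = i
      · subst hmi
        simp [hml]
        omega
      · simp [hml, hmi]
  · rw [hj']
    simp [hli.symm]
    omega

lemma minSum_supermodular (hw : ExchangeFamily w) (S T : Finset ι) :
    minSum w S + minSum w T ≤ minSum w (S ∪ T) + minSum w (S ∩ T) := by
  obtain ⟨j, hP, hQ⟩ := hw.exists_eq_minSum_of_subset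
    (inter_subset_left.trans subset_union_left : S ∩ T ⊆ S ∪ T)
  rw [← hP, ← hQ, sum_union_inter]
  exact add_le_add (minSum_le w S j) (minSum_le w T j)

/-- Bounding one coordinate by that of `a` keeps the partial sums of `a` dominating. -/
lemma exists_sum_le_of_coord_le (hw : ExchangeFamily w) (a : ι → ℤ)
    (ha : ∀ S, minSum w S ≤ ∑ i ∈ S, a i) (e : ι) (S : Finset ι) :
    ∃ j, w j e ≤ a e ∧ ∑ i ∈ S, w j i ≤ ∑ i ∈ S, a i := by
  obtain ⟨c, hc⟩ := exists_eq_minSum w {e}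
  replace hc : w c e ≤ a e := by simpa using hc.trans_le (ha {e})
  obtain ⟨j₀, hj₀S, hj₀⟩ := hw.exists_eq_minSum_of_subset (subset_insert e S)
  replace hj₀S := hj₀S.trans_le (ha S)
  replace hj₀ := hj₀.trans_le (ha (insert e S))
  rcases le_or_gt (w j₀ e) (a e) with hle | hlt
  · exact ⟨j₀, hle, hj₀S⟩
  obtain ⟨j, hj, hmin⟩ := exists_min_image
    (univ.filter fun j => ∑ i ∈ insert e S, w j i ≤ ∑ i ∈ insert e S, a i ∧ a e ≤ w j e)
    (fun j => w j e) ⟨j₀, by simpa using ⟨hj₀, hlt.le⟩⟩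
  rw [mem_filter_univ] at hj
  obtain ⟨hjS, hje⟩ := hj
  have heq : w j e = a e := by
    by_contra hne
    have hgt : a e < w j e := lt_of_le_of_ne hje (Ne.symm hne)
    obtain ⟨l, hl, j', hj'⟩ := hw j c e (hc.trans_lt hgt)
    have hle : l ≠ e := by rintro rfl; omega
    have hsum := sum_exchange (w j) l e (insert e S)
    rw [← hj', if_pos (mem_insert_self e S)] at hsum
    have hj'e : w j' e = w j e - 1 := by simp [hj', hle.symm]
    have := hmin j' (by
      rw [mem_filter_univ]
      refine ⟨?_, by omega⟩
      split_ifs at hsum <;> omega)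
    omega
  refine ⟨j, heq.le, ?_⟩
  by_cases heS : e ∈ S
  · rwa [insert_eq_of_mem heS] at hjS
  · rw [sum_insert heS, sum_insert heS] at hjS
    omega

/-- The coordinates in `U` can be bounded by those of `a` one at a time. -/
lemma exists_forall_mem_le (U : Finset ι) (a : ι → ℤ) {κ : Type*} [Fintype κ] {w : κ → ι → ℤ}
    (hw : ExchangeFamily w) (ha : ∀ S, ∃ j, ∑ i ∈ S, w j i ≤ ∑ i ∈ S, a i) :
    ∃ j, ∀ i ∈ U, w j i ≤ a i := by
  induction U using Finset.induction_on generalizing κ with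
  | empty => exact ⟨(ha ∅).choose, by simp⟩
  | insert e U he ih =>
    have : Nonempty κ := ⟨(ha ∅).choose⟩
    obtain ⟨⟨j, hje⟩, hj⟩ := ih (hw.subtype_le e (a e)) fun S => by
      obtain ⟨j, hje, hjS⟩ := hw.exists_sum_le_of_coord_le a
        (fun T => (minSum_le w T _).trans (ha T).choose_spec) e S
      exact ⟨⟨j, hje⟩, hjS⟩
    exact ⟨j, by simpa [hje] using hj⟩

/-- An integer vector whose partial sums dominate `minSum w` dominates a member of the family. -/
lemma exists_le (hw : ExchangeFamily w) (a : ι → ℤ)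
    (ha : ∀ S, minSum w S ≤ ∑ i ∈ S, a i) : ∃ j, w j ≤ a := by
  obtain ⟨j, hj⟩ := exists_forall_mem_le univ a hw fun S => by
    obtain ⟨j, hj⟩ := exists_eq_minSum w S
    exact ⟨j, hj.trans_le (ha S)⟩
  exact ⟨j, fun i => hj i (mem_univ i)⟩

/-- An integer vector whose partial sums dominate `k • minSum w` dominates a sum of `k` members
of the family. -/
lemma exists_sum_mul_le (hw : ExchangeFamily w) (k : ℕ) (x : ι → ℤ)
    (hx : ∀ S, k * minSum w S ≤ ∑ i ∈ S, x i) :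
    ∃ c : κ → ℕ, ∑ j, c j = k ∧ ∀ i, ∑ j, (c j : ℤ) * w j i ≤ x i := by
  classical
  induction k generalizing x with
  | zero => exact ⟨0, by simp, fun i => by simpa using hx {i}⟩
  | succ k ih =>
    obtain ⟨a, ha⟩ := exists_sum_between univ (minSum w)
      (fun S => ∑ i ∈ S, x i - k * minSum w S) hw.minSum_supermodular
      (fun S T => by
        have h1 := sum_union_inter (s₁ := S) (s₂ := T) (f := x)
        have h2 := mul_le_mul_of_nonneg_left (hw.minSum_supermodular S T)
          (Int.natCast_nonneg k)
        linarith)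
      (fun S => by
        have := hx S
        push_cast at this
        linarith)
      (minSum_empty w) (by simp [minSum_empty])
    obtain ⟨j, hj⟩ := hw.exists_le a fun S => (ha S (subset_univ S)).1
    obtain ⟨c, hck, hc⟩ := ih (x - w j) fun S => by
      have h1 := (ha S (subset_univ S)).2
      have h2 : ∑ i ∈ S, w j i ≤ ∑ i ∈ S, a i := sum_le_sum fun i _ => hj i
      simp only [Pi.sub_apply, sum_sub_distrib]
      linarith
    refine ⟨c + Pi.single j 1, by simp [sum_add_distrib, hck], fun i => ?_⟩
    have := hc i
    simp [add_mul, sum_add_distrib, Pi.single_apply] at this ⊢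
    linarith

end ExchangeFamily

lemma sum_smul_reesGen_castSucc (n q : ℕ) (v : Fin q → Fin n → ℕ) (lam : Fin n ⊕ Fin q → ℝ)
    (i : Fin n) :
    (∑ s, lam s • reesGen n q v s) i.castSucc =
      lam (Sum.inl i) + ∑ j, lam (Sum.inr j) * v j i := by
  simp [reesGen, Fintype.sum_sum_type, Finset.sum_apply, Pi.single_apply]

lemma sum_smul_reesGen_last (n q : ℕ) (v : Fin q → Fin n → ℕ) (lam : Fin n ⊕ Fin q → ℝ) :
    (∑ s, lam s • reesGen n q v s) (Fin.last n) = ∑ j, lam (Sum.inr j) := by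
  simp [reesGen, Fintype.sum_sum_type, Finset.sum_apply]

lemma sum_smul_reesGenZ_castSucc (n q : ℕ) (v : Fin q → Fin n → ℕ) (c : Fin n ⊕ Fin q → ℤ)
    (i : Fin n) :
    (∑ s, c s • reesGenZ n q v s) i.castSucc = c (Sum.inl i) + ∑ j, c (Sum.inr j) * v j i := by
  simp [reesGenZ, Fintype.sum_sum_type, Finset.sum_apply, Pi.single_apply]

lemma sum_smul_reesGenZ_last (n q : ℕ) (v : Fin q → Fin n → ℕ) (c : Fin n ⊕ Fin q → ℤ) :
    (∑ s, c s • reesGenZ n q v s) (Fin.last n) = ∑ j, c (Sum.inr j) := by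
  simp [reesGenZ, Fintype.sum_sum_type, Finset.sum_apply]

lemma exchangeFamily_natCast {ι κ : Type*} [DecidableEq ι] {v : κ → ι → ℕ}
    (hexch : ∀ j j' : κ, ∀ i, v j' i < v j i →
      ∃ l, v j l < v j' l ∧ ∃ j'' : κ, v j'' = v j + Pi.single l 1 - Pi.single i 1) :
    ExchangeFamily fun j i => (v j i : ℤ) := by
  intro j j' i hi
  rw [Nat.cast_lt] at hi
  obtain ⟨l, hl, j'', hj''⟩ := hexch j j' i hi
  refine ⟨l, Nat.cast_lt.mpr hl, j'', funext fun m => ?_⟩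
  simp only [hj'', Pi.sub_apply, Pi.add_apply]
  by_cases hm : m = i
  · subst hm
    by_cases hml : m = l
    · subst hml
      simp
    · simp [hml]
      omega
  · by_cases hml : m = l
    · subst hml
      simp [hm]
    · simp [hm, hml]

/-- If `v_1, …, v_q` are the bases of a discrete polymatroid of rank `d`, then
`𝒜' = {e_1, …, e_n, (v_1,1), …, (v_q,1)}` is an integral Hilbert basis: every
lattice point of the Rees cone is a nonnegative integer combination of elements
of `𝒜'`.  (Ring-theoretically: the Rees algebra of a polymatroidal ideal is
normal.) -/
theorem polymatroidal_ideal_rees_algebra_normal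
    (n q d : ℕ) (hq : 0 < q) (v : Fin q → Fin n → ℕ)
    (hd : ∀ j, ∑ i, v j i = d)
    (hexch : ∀ j j' : Fin q, ∀ i, v j' i < v j i →
      ∃ l, v j l < v j' l ∧ ∃ j'' : Fin q,
        v j'' = v j + Pi.single l 1 - Pi.single i 1)
    (z : Fin (n + 1) → ℤ) :
    (fun i => (z i : ℝ)) ∈ reesCone n q v ↔
      ∃ μ : Fin n ⊕ Fin q → ℕ, z = ∑ s, (μ s : ℤ) • reesGenZ n q v s := by
  constructor
  · rintro ⟨lam, hlam, hz⟩
    have : Nonempty (Fin q) := ⟨⟨0, hq⟩⟩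
    have hlast : (z (Fin.last n) : ℝ) = ∑ j, lam (Sum.inr j) :=
      (congrFun hz _).trans (sum_smul_reesGen_last n q v lam)
    have hcoord (i : Fin n) :
        (z i.castSucc : ℝ) = lam (Sum.inl i) + ∑ j, lam (Sum.inr j) * v j i :=
      (congrFun hz _).trans (sum_smul_reesGen_castSucc n q v lam i)
    obtain ⟨k, hk⟩ : ∃ k : ℕ, z (Fin.last n) = k := by
      refine Int.eq_ofNat_of_zero_le ?_
      have : (0 : ℝ) ≤ z (Fin.last n) := hlast ▸ sum_nonneg fun j _ => hlam _
      exact_mod_cast this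
    have hw := exchangeFamily_natCast hexch
    obtain ⟨c, hck, hc⟩ := hw.exists_sum_mul_le k (fun i => z i.castSucc) fun S => by
      have hle : (k : ℝ) * (minSum (fun j i => (v j i : ℤ)) S : ℤ) ≤
          ∑ i ∈ S, (z i.castSucc : ℝ) := by
        have hkr : (k : ℝ) = ∑ j, lam (Sum.inr j) := by rw [← hlast, hk, Int.cast_natCast]
        calc (k : ℝ) * (minSum (fun j i => (v j i : ℤ)) S : ℤ)
            = ∑ j, lam (Sum.inr j) * (minSum (fun j i => (v j i : ℤ)) S : ℤ) := by
              rw [hkr, sum_mul]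
          _ ≤ ∑ j, lam (Sum.inr j) * ∑ i ∈ S, (v j i : ℝ) := by
              refine sum_le_sum fun j _ => mul_le_mul_of_nonneg_left ?_ (hlam _)
              exact_mod_cast minSum_le (fun j i => (v j i : ℤ)) S j
          _ = ∑ i ∈ S, ∑ j, lam (Sum.inr j) * v j i := by
              simp only [mul_sum]
              exact sum_comm
          _ ≤ ∑ i ∈ S, (z i.castSucc : ℝ) := by
              refine sum_le_sum fun i _ => ?_
              rw [hcoord]
              exact le_add_of_nonneg_left (hlam _)
      exact_mod_cast hle
    refine ⟨Sum.elim (fun i => (z i.castSucc - ∑ j, (c j : ℤ) * v j i).toNat) c, ?_⟩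
    funext m
    induction m using Fin.lastCases with
    | last =>
      rw [sum_smul_reesGenZ_last, hk, ← hck]
      simp
    | cast i =>
      rw [sum_smul_reesGenZ_castSucc]
      simp only [Sum.elim_inl, Sum.elim_inr]
      rw [Int.toNat_of_nonneg (sub_nonneg.mpr (hc i))]
      ring
  · rintro ⟨μ, rfl⟩
    refine ⟨fun s => μ s, fun s => Nat.cast_nonneg _, funext fun m => ?_⟩
    induction m using Fin.lastCases with
    | last =>
      rw [sum_smul_reesGen_last, sum_smul_reesGenZ_last]
      push_cast
      rfl
    | cast i =>
      rw [sum_smul_reesGen_castSucc, sum_smul_reesGenZ_castSucc]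
      push_cast
      rfl
end

section
/- Let 𝒜 = {v_1,…,v_q} ⊆ ℕ^n be the set of bases of a discrete polymatroid of rank d, and let 𝒜' = {e_1,…,e_n, (v_1,1),…,(v_q,1)} ⊆ ℝ^{n+1}. Let b = (b_1,…,b_{n+1}) ∈ ℤ^{n+1} be a nonzero vector whose nonzero entries are relatively prime (have gcd 1), such that: (a) ℝ_+𝒜' ⊆ H_b^+ and ℝ_+𝒜' ∩ H_b ≠ ℝ_+𝒜', and (b) the set 𝒜' ∩ H_b contains n linearly independent vectors (so ℝ_+𝒜' ∩ H_b is a facet of the (n+1)-dimensional Rees cone ℝ_+𝒜'). Then either b = e_i for some i ∈ [n+1], or b_i ∈ {0,1} for all i ∈ [n] and b_{n+1} is a negative integer. In particular the Rees cone of a polymatroidal ideal is quasi-ideal. -/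
open Finset

/-- Two vectors orthogonal to the same `n` linearly independent vectors of `ℝ^{n+1}` are
proportional, provided the first one is nonzero. -/
lemma exists_eq_mul_of_dotProduct_eq_zero {n : ℕ} {ι : Type*} [Fintype ι]
    (hι : Fintype.card ι = n) (u : ι → Fin (n + 1) → ℝ) (hu : LinearIndependent ℝ u)
    (b b' : Fin (n + 1) → ℝ) (hb : b ≠ 0) (h : ∀ j, b ⬝ᵥ u j = 0) (h' : ∀ j, b' ⬝ᵥ u j = 0) :
    ∃ a : ℝ, ∀ i, b' i = a * b i := by
  obtain ⟨i, hi⟩ := Function.ne_iff.mp hb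
  simp only [Pi.zero_apply] at hi
  let f : (Fin (n + 1) → ℝ) →ₗ[ℝ] ℝ := dotProductBilin ℝ ℝ b
  let f' : (Fin (n + 1) → ℝ) →ₗ[ℝ] ℝ := dotProductBilin ℝ ℝ b'
  have hle : Submodule.span ℝ (Set.range u) ≤ LinearMap.ker f := by
    rw [Submodule.span_le]; rintro _ ⟨j, rfl⟩; exact h j
  have hle' : Submodule.span ℝ (Set.range u) ≤ LinearMap.ker f' := by
    rw [Submodule.span_le]; rintro _ ⟨j, rfl⟩; exact h' j
  have hf : f ≠ 0 := by
    intro h0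
    have : f (Pi.single i 1) = 0 := by rw [h0]; rfl
    exact hi (by simpa [f] using this)
  have heq : Submodule.span ℝ (Set.range u) = LinearMap.ker f := by
    apply Submodule.eq_of_le_of_finrank_eq hle
    rw [finrank_span_eq_card hu, hι]
    have := Module.Dual.finrank_ker_add_one_of_ne_zero hf
    simp at this
    omega
  refine ⟨b' i / b i, fun j => ?_⟩
  have hmem : b i • (Pi.single j 1 : Fin (n + 1) → ℝ) - b j • Pi.single i 1 ∈
      LinearMap.ker f := by
    simp [f, mul_comm]
  rw [← heq] at hmem
  have := hle' hmem
  simp [f'] at this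
  field_simp
  linarith

/-- Effect of an exchange `x - e_i + e_l` on the weight of `x` with respect to `c`. -/
lemma sum_mul_exchange {n : ℕ} {x y : Fin n → ℕ} {i l : Fin n} (hi : 0 < x i) (hil : l ≠ i)
    (hy : y = x + Pi.single l 1 - Pi.single i 1) (c : Fin n → ℤ) :
    ∑ k, c k * (y k : ℤ) = ∑ k, c k * (x k : ℤ) + c l - c i := by
  have h : ∀ k, (y k : ℤ) = x k + (Pi.single l 1 : Fin n → ℤ) k -
      (Pi.single i 1 : Fin n → ℤ) k := by
    intro k
    by_cases hk : k = i
    · subst hk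
      simp [hy, hil.symm]
      omega
    · simp only [hy, Pi.add_apply, Pi.sub_apply, Pi.single_apply, hk, if_false]
      split_ifs <;> simp
  simp_rw [h, mul_sub, mul_add, Finset.sum_sub_distrib, Finset.sum_add_distrib]
  simp [Pi.single_apply]

/-- Bases of minimal `c`-weight have the same degree on each upper level set of `c`. -/
lemma sum_levelSet_le {n q : ℕ} {v : Fin q → Fin n → ℕ}
    (hexch : ∀ j j' : Fin q, ∀ i, v j' i < v j i →
      ∃ l, v j l < v j' l ∧ ∃ j'' : Fin q,
        v j'' = v j + Pi.single l 1 - Pi.single i 1)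
    (c : Fin n → ℤ) (m a : ℤ) (hmin : ∀ j, m ≤ ∑ i, c i * (v j i : ℤ))
    (j j' : Fin q) (hj : ∑ i, c i * (v j i : ℤ) = m) (hj' : ∑ i, c i * (v j' i : ℤ) = m) :
    ∑ i, (if a ≤ c i then 1 else 0) * (v j i : ℤ) ≤
      ∑ i, (if a ≤ c i then 1 else 0) * (v j' i : ℤ) := by
  induction hN : ∑ k, (v j k - v j' k) using Nat.strong_induction_on generalizing j with
  | _ N ih =>
  by_cases hne : ∃ i, a ≤ c i ∧ v j' i < v j i
  swap
  · push Not at hne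
    refine Finset.sum_le_sum fun i _ => ?_
    split_ifs with h
    · simpa using hne i h
    · simp
  obtain ⟨i, hi, himax⟩ := Finset.exists_max_image
    (Finset.univ.filter fun i => a ≤ c i ∧ v j' i < v j i) c
    (by obtain ⟨i, hi⟩ := hne; exact ⟨i, by simpa using hi⟩)
  simp only [Finset.mem_filter, Finset.mem_univ, true_and] at hi himax
  obtain ⟨hai, hlt⟩ := hi
  obtain ⟨l, hl, j₁, hj₁⟩ := hexch j j' i hlt
  have hli : l ≠ i := by rintro rfl; omega
  have hsum := sum_mul_exchange (by omega) hli hj₁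
  have hcl : c i ≤ c l := by have := hmin j₁; rw [hsum c] at this; omega
  obtain ⟨k, hk, j₂, hj₂⟩ := hexch j' j l hl
  have hkl : k ≠ l := by rintro rfl; omega
  have hck : c l ≤ c k := by
    have := hmin j₂
    rw [sum_mul_exchange (by omega) hkl hj₂ c] at this
    omega
  have hki := himax k ⟨by omega, hk⟩
  have hceq : c l = c i := by omega
  have hlevel := hsum fun x => if a ≤ c x then 1 else 0
  simp only [hceq] at hlevel
  have hrec := ih (∑ k, (v j₁ k - v j' k)) ?_ j₁ (by rw [hsum c]; omega) rfl
  · omega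
  · rw [← hN, hj₁]
    refine Finset.sum_lt_sum (fun k _ => ?_) ⟨i, Finset.mem_univ _, ?_⟩
    · simp only [Pi.add_apply, Pi.sub_apply, Pi.single_apply]
      split_ifs with h1 h2 <;> subst_vars <;> omega
    · simp only [Pi.add_apply, Pi.sub_apply, Pi.single_apply, if_neg hli.symm, if_true]
      omega

lemma reesGen_mem_reesCone {n q : ℕ} (v : Fin q → Fin n → ℕ) (s : Fin n ⊕ Fin q) :
    reesGen n q v s ∈ reesCone n q v := by
  classical
  refine ⟨Pi.single s 1, fun t => ?_, ?_⟩
  · simp only [Pi.single_apply]; split_ifs <;> simp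
  · rw [Finset.sum_eq_single s] <;> simp +contextual

lemma reesGen_nonneg {n q : ℕ} (v : Fin q → Fin n → ℕ) (s : Fin n ⊕ Fin q) (i : Fin (n + 1)) :
    0 ≤ reesGen n q v s i := by
  rcases s with s | s
  · simp only [reesGen, Pi.single_apply]; split_ifs <;> simp
  · refine Fin.lastCases ?_ (fun i => ?_) i <;> simp [reesGen]

lemma dotProduct_reesGen_inl {n q : ℕ} (v : Fin q → Fin n → ℕ) (b : Fin (n + 1) → ℝ) (i : Fin n) :
    ∑ k, b k * reesGen n q v (Sum.inl i) k = b i.castSucc := by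
  simp [reesGen, Pi.single_apply]

lemma dotProduct_reesGen_inr {n q : ℕ} (v : Fin q → Fin n → ℕ) (b : Fin (n + 1) → ℝ) (j : Fin q) :
    ∑ k, b k * reesGen n q v (Sum.inr j) k =
      ∑ i : Fin n, b i.castSucc * (v j i : ℝ) + b (Fin.last n) := by
  simp [reesGen, Fin.sum_univ_castSucc]

/-- A primitive integer vector all of whose entries are divisible by `k ≥ 0` forces `k = 1`. -/
lemma eq_one_of_gcd_eq_one {ι : Type*} [Fintype ι] {b : ι → ℤ} (hb : Finset.univ.gcd b = 1)
    {k : ℤ} (hk : 0 ≤ k) (h : ∀ i, k ∣ b i) : k = 1 := by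
  have : k ∣ 1 := hb ▸ Finset.dvd_gcd fun i _ => h i
  exact Int.eq_one_of_dvd_one hk this

/-- Facets of the Rees cone of a polymatroidal ideal: let `v_1, …, v_q` be the
bases of a discrete polymatroid of rank `d`, and let `b` be a primitive integral
supporting normal of a facet of the Rees cone.  Then either `b` is a unit vector,
or all its first `n` entries are in `{0,1}` and its last entry is negative.
In particular the Rees cone of a polymatroidal ideal is quasi-ideal. -/
theorem polymatroid_rees_cone_facets
    (n q d : ℕ) (hq : 0 < q) (v : Fin q → Fin n → ℕ)
    (hd : ∀ j, ∑ i, v j i = d)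
    (hexch : ∀ j j' : Fin q, ∀ i, v j' i < v j i →
      ∃ l, v j l < v j' l ∧ ∃ j'' : Fin q,
        v j'' = v j + Pi.single l 1 - Pi.single i 1)
    (b : Fin (n + 1) → ℤ) (hb0 : b ≠ 0)
    (hprim : Finset.univ.gcd b = 1)
    (hsupp : reesCone n q v ⊆ {y | 0 ≤ ∑ i, (b i : ℝ) * y i})
    (hproper : reesCone n q v ∩ {y | ∑ i, (b i : ℝ) * y i = 0} ≠ reesCone n q v)
    (hfacet : ∃ s : Finset (Fin n ⊕ Fin q), s.card = n ∧
      (∀ j ∈ s, ∑ i, (b i : ℝ) * reesGen n q v j i = 0) ∧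
      LinearIndependent ℝ (fun j : s => reesGen n q v (j : Fin n ⊕ Fin q))) :
    (∃ i : Fin (n + 1), b = Pi.single i 1) ∨
      ((∀ i : Fin n, b i.castSucc = 0 ∨ b i.castSucc = 1) ∧
        b (Fin.last n) < 0) := by
  have hgen : ∀ s, 0 ≤ ∑ i, (b i : ℝ) * reesGen n q v s i :=
    fun s => hsupp (reesGen_mem_reesCone v s)
  have hc : ∀ i : Fin n, 0 ≤ b i.castSucc := fun i => by
    have := hgen (Sum.inl i)
    rw [dotProduct_reesGen_inl v fun i => (b i : ℝ)] at this
    exact_mod_cast this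
  have hv : ∀ j, 0 ≤ ∑ i : Fin n, b i.castSucc * (v j i : ℤ) + b (Fin.last n) := fun j => by
    have := hgen (Sum.inr j)
    rw [dotProduct_reesGen_inr v fun i => (b i : ℝ)] at this
    exact_mod_cast this
  obtain ⟨s, hs, hs0, hli⟩ := hfacet
  have hbR : (fun i => (b i : ℝ)) ≠ 0 := fun h => hb0 <| funext fun i => by
    simpa using congrFun h i
  have hprop : ∀ b' : Fin (n + 1) → ℝ,
      (∀ j ∈ s, ∑ i, b' i * reesGen n q v j i = 0) → ∃ a : ℝ, ∀ i, b' i = a * b i :=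
    fun b' hb' => exists_eq_mul_of_dotProduct_eq_zero (by simpa using hs) _ hli
      (fun i => (b i : ℝ)) b' hbR (fun j => hs0 j j.2) (fun j => hb' j j.2)
  rcases lt_or_ge (b (Fin.last n)) 0 with ht | ht
  · right
    refine ⟨?_, ht⟩
    obtain ⟨i₀, hi₀⟩ : ∃ i : Fin n, 0 < b i.castSucc := by
      by_contra! h
      have h0 : ∀ i : Fin n, b i.castSucc = 0 := fun i => le_antisymm (h i) (hc i)
      have := hv ⟨0, hq⟩
      simp [h0] at this
      omega
    let w : Fin n → ℤ := fun i => if b i₀.castSucc ≤ b i.castSucc then 1 else 0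
    obtain ⟨r, hr⟩ : ∃ r : ℤ, ∀ j, ∑ i : Fin n, b i.castSucc * (v j i : ℤ) = -b (Fin.last n) →
        ∑ i, w i * (v j i : ℤ) = r := by
      by_cases h : ∃ j, ∑ i : Fin n, b i.castSucc * (v j i : ℤ) = -b (Fin.last n)
      · obtain ⟨j, hj⟩ := h
        have key := sum_levelSet_le hexch (fun i => b i.castSucc) (-b (Fin.last n))
          (b i₀.castSucc) (fun j => by linarith [hv j])
        exact ⟨_, fun j' hj' => le_antisymm (key j' j hj' hj) (key j j' hj hj')⟩
      · push Not at h
        exact ⟨0, fun j hj => absurd hj (h j)⟩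
    obtain ⟨a, ha⟩ := hprop (Fin.snoc (fun i => (w i : ℝ)) (-r : ℝ)) fun j hj => by
      have hj0 := hs0 j hj
      rcases j with i | j
      · rw [dotProduct_reesGen_inl v fun i => (b i : ℝ)] at hj0
        rw [dotProduct_reesGen_inl, Fin.snoc_castSucc]
        have : b i.castSucc = 0 := by exact_mod_cast hj0
        simp [w, this, hi₀]
      · rw [dotProduct_reesGen_inr v fun i => (b i : ℝ)] at hj0
        rw [dotProduct_reesGen_inr]
        simp only [Fin.snoc_castSucc, Fin.snoc_last]
        have hj1 : ∑ i : Fin n, b i.castSucc * (v j i : ℤ) + b (Fin.last n) = 0 := by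
          exact_mod_cast hj0
        have := hr j (by linarith)
        rw [← this]
        push_cast
        ring
    have hw : ∀ i, (w i : ℝ) = a * b i.castSucc := fun i => by simpa using ha i.castSucc
    have hlast : (-r : ℝ) = a * b (Fin.last n) := by simpa using ha (Fin.last n)
    have ha₀ : a * b i₀.castSucc = 1 := by rw [← hw]; simp [w]
    have hcast : ∀ i, b i.castSucc = b i₀.castSucc * w i := fun i => by
      have : (b i.castSucc : ℝ) = b i₀.castSucc * w i := by
        rw [hw]; linear_combination -(b i.castSucc : ℝ) * ha₀
      exact_mod_cast this
    have hblast : b (Fin.last n) = b i₀.castSucc * -r := by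
      have : (b (Fin.last n) : ℝ) = b i₀.castSucc * -r := by
        rw [hlast]; linear_combination -(b (Fin.last n) : ℝ) * ha₀
      exact_mod_cast this
    have hone : b i₀.castSucc = 1 := eq_one_of_gcd_eq_one hprim hi₀.le
      (Fin.lastCases ⟨_, hblast⟩ fun i => ⟨_, hcast i⟩)
    intro i
    rw [hcast i, hone, one_mul]
    simp only [w]
    split_ifs <;> simp
  · left
    have hb : ∀ i, 0 ≤ b i := Fin.lastCases ht hc
    obtain ⟨i, hi⟩ := Function.ne_iff.mp hb0
    simp only [Pi.zero_apply] at hi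
    have hiR : (b i : ℝ) ≠ 0 := by exact_mod_cast hi
    obtain ⟨a, ha⟩ := hprop (Pi.single i 1) fun j hj => by
      have h0 := (Finset.sum_eq_zero_iff_of_nonneg fun k _ =>
        mul_nonneg (Int.cast_nonneg (hb k)) (reesGen_nonneg v j k)).mp (hs0 j hj) i
        (Finset.mem_univ i)
      simpa [Pi.single_apply] using (mul_eq_zero.mp h0).resolve_left hiR
    have hai : 1 = a * b i := by simpa using ha i
    have hzero : ∀ k, k ≠ i → b k = 0 := fun k hk => by
      have h1 := ha k
      rw [Pi.single_eq_of_ne hk] at h1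
      have ha0 : a ≠ 0 := by rintro rfl; simp at hai
      exact_mod_cast (mul_eq_zero.mp h1.symm).resolve_left ha0
    have hone : b i = 1 := eq_one_of_gcd_eq_one hprim (hb i) fun k => by
      by_cases hk : k = i
      · rw [hk]
      · rw [hzero k hk]; exact dvd_zero _
    refine ⟨i, funext fun k => ?_⟩
    by_cases hk : k = i
    · rw [hk, hone, Pi.single_eq_same]
    · rw [hzero k hk, Pi.single_eq_of_ne hk]
end
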